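/- arXiv:1904.06981 — 2 statements merged into one kernel-verified Lean document; each statement's English description precedes it below -/
import Mathlib

section
/- Consider the (μ,λ) EA on the n-dimensional OneMax function with λ ≥ e·μ and μ ≥ n^{2/3}·(ln n)^4. Then there is a constant C such that for all sufficiently large n, the expected number of generations until the current level of the population first exceeds n/3 is at most C·n. -/
open Finset
open scoped ENNReal

attribute [local instance] Classical.propDecidable

/-- Search points: bit strings of length `n`. -/
abbrev Pt (n : ℕ) := Fin n → Bool

/-- The OneMax fitness: the number of one-bits. -/
noncomputable def oneMax {n : ℕ} (x : Pt n) : ℕ := (univ.filter (fun i => x i = true)).card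

/-- The all-ones string (the unique optimum of OneMax). -/
noncomputable def allOnes (n : ℕ) : Pt n := fun _ => true

/-- Probability that standard-bit mutation (flip each bit independently with
probability `1/n`) turns `x` into `y`. -/
noncomputable def mutProb (n : ℕ) (x y : Pt n) : ℝ :=
  ∏ i : Fin n, (if y i = x i then 1 - 1 / (n : ℝ) else 1 / (n : ℝ))

/-- `binomPr m p k` is the probability that a `Bin(m, p)` random variable equals `k`. -/
noncomputable def binomPr (m : ℕ) (p : ℝ) (k : ℕ) : ℝ :=
  (m.choose k : ℝ) * p ^ k * (1 - p) ^ (m - k)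

/-- Probability that `min μ B = j`, where `B ~ Bin(lam, p)`. -/
noncomputable def binomTruncPr (μ lam : ℕ) (p : ℝ) (j : ℕ) : ℝ :=
  if j < μ then binomPr lam p j
  else if j = μ then ∑ k ∈ Finset.Icc μ lam, binomPr lam p k
  else 0

/-- The potential of a single individual. -/
noncomputable def gPot (n : ℕ) (τ : ℝ) (f₀ : ℕ) (x : Pt n) : ℝ :=
  if f₀ ≤ oneMax x then τ ^ (oneMax x - f₀) else 0

/-- The potential of a population. -/
noncomputable def gPop (n μ : ℕ) (τ : ℝ) (f₀ : ℕ) (P : Fin μ → Pt n) : ℝ :=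
  ∑ i, gPot n τ f₀ (P i)

/-- Probability that one offspring-creation step (choose a parent uniformly at random
from the population `P`, then apply standard-bit mutation) produces `y`. -/
noncomputable def offProb (n μ : ℕ) (P : Fin μ → Pt n) (y : Pt n) : ℝ :=
  (∑ i, mutProb n (P i) y) / (μ : ℝ)

/-- Probability that the `lam` independently created offspring are exactly `o`. -/
noncomputable def offVecProb (n μ lam : ℕ) (P : Fin μ → Pt n) (o : Fin lam → Pt n) : ℝ :=
  ∏ j, offProb n μ P (o j)

/-- `s` selects `μ` of the `lam` offspring `o` having the largest OneMax values. -/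
def validSel {n μ lam : ℕ} (o : Fin lam → Pt n) (s : Fin μ → Fin lam) : Prop :=
  Function.Injective s ∧
    ∀ j : Fin lam, (∀ i, s i ≠ j) → ∀ i, oneMax (o j) ≤ oneMax (o (s i))

/-- Transition probability of the (μ,λ) EA on OneMax: the probability that the next
population is `Q`, given that the current one is `P`; the `μ` best of the `lam`
offspring are selected, ties broken uniformly at random. -/
noncomputable def stepProb (n μ lam : ℕ) (P Q : Fin μ → Pt n) : ℝ :=
  ∑ o : Fin lam → Pt n, offVecProb n μ lam P o *
    (((univ.filter (fun s : Fin μ → Fin lam => validSel o s ∧ o ∘ s = Q)).card : ℝ) /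
      ((univ.filter (fun s : Fin μ → Fin lam => validSel o s)).card : ℝ))

/-- Probability of observing the population path `path`, where the initial population
consists of `μ` individuals chosen independently and uniformly at random. -/
noncomputable def pathProb (n μ lam : ℕ) {t : ℕ} (path : Fin (t + 1) → Fin μ → Pt n) : ℝ :=
  ((1 : ℝ) / 2 ^ n) ^ μ * ∏ s : Fin t, stepProb n μ lam (path s.castSucc) (path s.succ)

/-- Probability that none of the populations `P_0, …, P_t` contains the optimum. -/
noncomputable def survProb (n μ lam t : ℕ) : ℝ :=
  ∑ path ∈ (univ : Finset (Fin (t + 1) → Fin μ → Pt n)).filter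
      (fun path => ∀ s i, path s i ≠ allOnes n),
    pathProb n μ lam path

/-- Expected number of generations of the (μ,λ) EA on OneMax until the all-ones
string is first generated. -/
noncomputable def expGens (n μ lam : ℕ) : ℝ≥0∞ :=
  ∑' t : ℕ, ENNReal.ofReal (survProb n μ lam t)

/-- Expected runtime (number of fitness evaluations) of the (μ,λ) EA on OneMax:
`μ` evaluations for the initial population plus `lam` per generation. -/
noncomputable def expRuntime (n μ lam : ℕ) : ℝ≥0∞ :=
  (μ : ℝ≥0∞) + (lam : ℝ≥0∞) * expGens n μ lam

/-- Number of individuals of the population with fitness exactly `φ`. -/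
noncomputable def cntEq {n μ : ℕ} (P : Fin μ → Pt n) (φ : ℕ) : ℕ :=
  (univ.filter (fun i => oneMax (P i) = φ)).card

/-- Number of individuals of the population with fitness strictly greater than `φ`. -/
noncomputable def cntGt {n μ : ℕ} (P : Fin μ → Pt n) (φ : ℕ) : ℕ :=
  (univ.filter (fun i => φ < oneMax (P i))).card

/-- `φ` is the current level at generation `t` of the population path `path`. -/
def isCurLevel {n : ℕ} (μ : ℕ) (path : ℕ → Fin μ → Pt n) (t φ : ℕ) : Prop :=
  ∃ t₀ < t, (μ : ℝ) / 2 ≤ (cntEq (path t₀) φ : ℝ) + (cntGt (path t₀) φ : ℝ) ∧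
    ∀ τ, t₀ ≤ τ → τ ≤ t →
      (μ : ℝ) / 4 ≤ (cntEq (path τ) φ : ℝ) + (cntGt (path τ) φ : ℝ) ∧
        (cntGt (path τ) φ : ℝ) < (μ : ℝ) / 2

/-- Probability that the population path of length `t + 1` of the (μ,λ) EA started
from the fixed population `P₀` satisfies the predicate `good`. -/
noncomputable def prEvent (n μ lam : ℕ) (P₀ : Fin μ → Pt n) (t : ℕ)
    (good : (Fin (t + 1) → Fin μ → Pt n) → Prop) : ℝ :=
  ∑ path ∈ (univ : Finset (Fin (t + 1) → Fin μ → Pt n)).filter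
      (fun path => path 0 = P₀ ∧ good path),
    ∏ s : Fin t, stepProb n μ lam (path s.castSucc) (path s.succ)

/-- The population `Q` has lost the level `φ`: fewer than `μ/4` individuals have
fitness at least `φ`. -/
def lostLevel {n μ : ℕ} (φ : ℕ) (Q : Fin μ → Pt n) : Prop :=
  (cntEq Q φ : ℝ) + (cntGt Q φ : ℝ) < (μ : ℝ) / 4

/-- The population `Q` has gained a level over `φ`: at least `μ/2` individuals have
fitness strictly greater than `φ`. -/
def gainLevel {n μ : ℕ} (φ : ℕ) (Q : Fin μ → Pt n) : Prop :=
  (μ : ℝ) / 2 ≤ (cntGt Q φ : ℝ)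

/-- Probability that up to generation `t` no fitness level exceeding `n/3` has become
the current level of the (μ,λ) EA on OneMax (started from a uniform random initial
population), i.e. `Pr[T > t]` for the first time `T` at which the current level
exceeds `n/3`. -/
noncomputable def survLevelThird (n μ lam t : ℕ) : ℝ :=
  ∑ path ∈ (univ : Finset (Fin (t + 1) → Fin μ → Pt n)).filter (fun path =>
      ∀ s : Fin (t + 1), ¬ ∃ φ : ℕ, (n : ℝ) / 3 < (φ : ℝ) ∧
        isCurLevel μ (fun u => if hu : u < t + 1 then path ⟨u, hu⟩ else path (Fin.last t))
          s.val φ),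
    pathProb n μ lam path

/-! Helper material. -/

theorem aux_pathSum {α : Type*} [Fintype α] (M : α → α → ℝ) (v : ℕ → α → ℝ)
    (h0 : ∀ P, v 0 P = 1) (h1 : ∀ t P, v (t + 1) P = ∑ Q, M P Q * v t Q) (t : ℕ) :
    ∀ h : α → ℝ, ∑ path : Fin (t + 1) → α,
      h (path 0) * ∏ s : Fin t, M (path s.castSucc) (path s.succ) = ∑ P, h P * v t P := by
  induction t with
  | zero =>
    intro h
    simp only [Finset.univ_eq_empty, Finset.prod_empty, h0]
    exact Fintype.sum_equiv (Equiv.funUnique (Fin 1) α) _ _ (fun x => by simp [Equiv.funUnique])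
  | succ t ih =>
    intro h
    rw [← (Fin.consEquiv (fun _ : Fin (t + 2) => α)).sum_comp, Fintype.sum_prod_type]
    refine Finset.sum_congr rfl fun P _ => ?_
    rw [h1, ← ih (fun Q => M P Q), Finset.mul_sum]
    refine Finset.sum_congr rfl fun p _ => ?_
    rw [Fin.prod_univ_succ]
    simp [Fin.consEquiv]

theorem aux_mut_nonneg {n : ℕ} (x y : Pt n) : 0 ≤ mutProb n x y := by
  unfold mutProb
  refine Finset.prod_nonneg fun i _ => ?_
  have hn : (1 : ℝ) ≤ n := by exact_mod_cast Fin.pos i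
  have : 1 / (n : ℝ) ≤ 1 := by rw [div_le_one (by linarith)]; exact hn
  split_ifs
  · linarith
  · positivity

theorem aux_mut_sum {n : ℕ} (x : Pt n) : ∑ y, mutProb n x y = 1 := by
  unfold mutProb
  have := (Finset.prod_univ_sum (fun _ : Fin n => (Finset.univ : Finset Bool))
    (fun i b => if b = x i then 1 - 1 / (n : ℝ) else 1 / (n : ℝ))).symm
  rw [Fintype.piFinset_univ] at this
  rw [this]
  refine Finset.prod_eq_one fun i _ => ?_
  rw [Fintype.sum_bool]
  cases x i <;> simp

theorem aux_off_nonneg {n μ : ℕ} (P : Fin μ → Pt n) (y : Pt n) : 0 ≤ offProb n μ P y := by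
  unfold offProb
  exact div_nonneg (Finset.sum_nonneg fun i _ => aux_mut_nonneg _ _) (by positivity)

theorem aux_off_sum {n μ : ℕ} (hμ : 0 < μ) (P : Fin μ → Pt n) : ∑ y, offProb n μ P y = 1 := by
  unfold offProb
  rw [← Finset.sum_div, Finset.sum_comm]
  have : (μ : ℝ) ≠ 0 := by positivity
  simp [aux_mut_sum, this]

theorem aux_offVec_nonneg {n μ lam : ℕ} (P : Fin μ → Pt n) (o : Fin lam → Pt n) :
    0 ≤ offVecProb n μ lam P o :=
  Finset.prod_nonneg fun _ _ => aux_off_nonneg _ _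

theorem aux_offVec_mgf {n μ lam : ℕ} (P : Fin μ → Pt n) (w : Pt n → ℝ) :
    ∑ o : Fin lam → Pt n, offVecProb n μ lam P o * ∏ j, w (o j)
      = (∑ y, offProb n μ P y * w y) ^ lam := by
  unfold offVecProb
  have := (Finset.prod_univ_sum (fun _ : Fin lam => (Finset.univ : Finset (Pt n)))
    (fun _ y => offProb n μ P y * w y)).symm
  rw [Fintype.piFinset_univ] at this
  simp only [← Finset.prod_mul_distrib]
  rw [this]
  simp

theorem aux_step_nonneg {n μ lam : ℕ} (P Q : Fin μ → Pt n) : 0 ≤ stepProb n μ lam P Q :=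
  Finset.sum_nonneg fun o _ => mul_nonneg (aux_offVec_nonneg _ _) (by positivity)

noncomputable def auxGe {n μ : ℕ} (P : Fin μ → Pt n) (φ : ℕ) : ℕ :=
  (univ.filter (fun i => φ ≤ oneMax (P i))).card

theorem auxGe_eq {n μ : ℕ} (P : Fin μ → Pt n) (φ : ℕ) :
    (cntEq P φ : ℝ) + (cntGt P φ : ℝ) = auxGe P φ := by
  unfold cntEq cntGt auxGe
  rw [← Nat.cast_add, ← Finset.card_union_of_disjoint]
  · congr 2
    ext i
    simp only [mem_union, mem_filter, mem_univ, true_and]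
    omega
  · rw [Finset.disjoint_filter]
    intro i _ h
    omega

theorem auxGe_succ {n μ : ℕ} (P : Fin μ → Pt n) (φ : ℕ) : auxGe P (φ + 1) = cntGt P φ := rfl

/-- sum of step probabilities over a set, bounded through an indicator on the offspring -/
theorem aux_step_set {n μ lam : ℕ} (P : Fin μ → Pt n) (B : Finset (Fin μ → Pt n))
    (g : (Fin lam → Pt n) → ℝ) (hg0 : ∀ o, 0 ≤ g o)
    (hg : ∀ o, ∀ s : Fin μ → Fin lam, validSel o s → o ∘ s ∈ B → 1 ≤ g o) :
    ∑ Q ∈ B, stepProb n μ lam P Q ≤ ∑ o, offVecProb n μ lam P o * g o := by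
  unfold stepProb
  rw [Finset.sum_comm]
  refine Finset.sum_le_sum fun o _ => ?_
  rw [← Finset.mul_sum]
  refine mul_le_mul_of_nonneg_left ?_ (aux_offVec_nonneg _ _)
  rw [← Finset.sum_div, ← Nat.cast_sum]
  have key : ∑ Q ∈ B, (univ.filter (fun s : Fin μ → Fin lam => validSel o s ∧ o ∘ s = Q)).card
      = (univ.filter (fun s : Fin μ → Fin lam => validSel o s ∧ o ∘ s ∈ B)).card := by
    rw [Finset.card_eq_sum_card_fiberwise (f := fun s : Fin μ → Fin lam => o ∘ s) (t := B)]
    · refine Finset.sum_congr rfl fun Q hQ => ?_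
      congr 1
      ext s
      simp only [mem_filter, mem_univ, true_and]
      constructor
      · rintro ⟨h1, h2⟩
        exact ⟨⟨h1, h2 ▸ hQ⟩, h2⟩
      · rintro ⟨⟨h1, _⟩, h2⟩
        exact ⟨h1, h2⟩
    · intro s hs
      simp at hs
      exact hs.2
  rw [key]
  by_cases hne : (univ.filter (fun s : Fin μ → Fin lam => validSel o s ∧ o ∘ s ∈ B)).Nonempty
  · obtain ⟨s, hs⟩ := hne
    simp only [mem_filter, mem_univ, true_and] at hs
    refine le_trans (div_le_one_of_le₀ ?_ (by positivity)) (hg o s hs.1 hs.2)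
    exact_mod_cast Finset.card_le_card (fun s hs => by
      simp only [mem_filter, mem_univ, true_and] at hs ⊢
      exact hs.1)
  · rw [Finset.not_nonempty_iff_eq_empty.1 hne]
    simpa using hg0 o

theorem aux_step_sum {n μ lam : ℕ} (hμ : 0 < μ) (P : Fin μ → Pt n) :
    ∑ Q, stepProb n μ lam P Q ≤ 1 := by
  refine (aux_step_set P univ (fun _ => 1) (fun _ => zero_le_one) (fun _ _ _ _ => le_rfl)).trans ?_
  have := aux_offVec_mgf (lam := lam) P (fun _ => 1)
  simp only [Finset.prod_const_one, mul_one, aux_off_sum hμ, one_pow] at this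
  simp [this]

theorem aux_sel {n μ lam : ℕ} (o : Fin lam → Pt n) (s : Fin μ → Fin lam) (hs : validSel o s)
    (φ : ℕ) (h : auxGe (o ∘ s) φ < μ) : auxGe o φ ≤ auxGe (o ∘ s) φ := by
  obtain ⟨hinj, hv⟩ := hs
  have : ∃ i, oneMax (o (s i)) < φ := by
    by_contra hc
    push Not at hc
    unfold auxGe at h
    rw [Finset.filter_true_of_mem (p := fun i => φ ≤ oneMax ((o ∘ s) i)) (fun i _ => hc i)] at h
    simp at h
  obtain ⟨i, hi⟩ := this
  unfold auxGe
  rw [← Finset.card_image_of_injective _ hinj]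
  refine Finset.card_le_card fun j hj => ?_
  simp only [mem_filter, mem_univ, true_and] at hj
  simp only [mem_image, mem_filter, mem_univ, true_and]
  by_contra hc
  have hj' : ∀ k, s k ≠ j := fun k hk => hc ⟨k, by simpa [hk] using hj, hk⟩
  have := hv j hj' i
  omega

/-- one-step concentration -/
theorem aux_chernoff {n μ lam : ℕ} (hμ : 0 < μ) (P : Fin μ → Pt n) (φ : ℕ) (r κ : ℝ)
    (hκ : κ ≤ 1) (hr : 1.01 * (κ + 0.005) ≤ r)
    (hq : r * μ ≤ lam * ∑ y ∈ univ.filter (fun y => φ ≤ oneMax y), offProb n μ P y) :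
    ∑ Q ∈ univ.filter (fun Q : Fin μ → Pt n => (auxGe Q φ : ℝ) < κ * μ), stepProb n μ lam P Q
      ≤ Real.exp (-(μ : ℝ) / 20000) := by
  set q := ∑ y ∈ univ.filter (fun y => φ ≤ oneMax y), offProb n μ P y with hqd
  have hμ' : (0 : ℝ) < μ := by exact_mod_cast hμ
  set w : Pt n → ℝ := fun y => if φ ≤ oneMax y then Real.exp (-0.01) else 1 with hw
  have hprod : ∀ o : Fin lam → Pt n, ∏ j, w (o j) = Real.exp (-0.01 * auxGe o φ) := by
    intro o
    simp only [hw, auxGe]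
    rw [Finset.prod_ite, Finset.prod_const, Finset.prod_const_one, mul_one, ← Real.exp_nat_mul]
    congr 1; ring
  have hw1 : ∑ y, offProb n μ P y * w y = 1 - q * (1 - Real.exp (-0.01)) := by
    have h := aux_off_sum hμ P
    have h' : ∑ y, offProb n μ P y * w y = ∑ y, offProb n μ P y - q * (1 - Real.exp (-0.01)) := by
      rw [hqd, Finset.sum_filter, Finset.sum_mul, ← Finset.sum_sub_distrib]
      refine Finset.sum_congr rfl fun y _ => ?_
      simp only [hw]
      split_ifs <;> ring
    rw [h', h]
  refine (aux_step_set P _ (fun o => Real.exp (0.01 * (κ * μ)) * ∏ j, w (o j)) ?_ ?_).trans ?_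
  · intro o; rw [hprod]; positivity
  · intro o s hs hB
    simp only [mem_filter, mem_univ, true_and] at hB
    rw [hprod, ← Real.exp_add]
    refine Real.one_le_exp ?_
    have h1 : auxGe (o ∘ s) φ < μ := by
      have : (auxGe (o ∘ s) φ : ℝ) < μ := by nlinarith
      exact_mod_cast this
    have h2 : (auxGe o φ : ℝ) ≤ auxGe (o ∘ s) φ := by exact_mod_cast aux_sel o s hs φ h1
    nlinarith
  · have : ∀ o : Fin lam → Pt n, offVecProb n μ lam P o * (Real.exp (0.01 * (κ * μ)) * ∏ j, w (o j))
        = Real.exp (0.01 * (κ * μ)) * (offVecProb n μ lam P o * ∏ j, w (o j)) := fun o => by ring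
    simp only [this]
    rw [← Finset.mul_sum, aux_offVec_mgf, hw1]
    have h3 : 0 ≤ 1 - q * (1 - Real.exp (-0.01)) := by
      rw [← hw1]
      refine Finset.sum_nonneg fun y _ => mul_nonneg (aux_off_nonneg _ _) ?_
      simp only [hw]; split_ifs <;> positivity
    have h4 : 1 - q * (1 - Real.exp (-0.01)) ≤ Real.exp (-(q * (1 - Real.exp (-0.01)))) := by
      have := Real.add_one_le_exp (-(q * (1 - Real.exp (-0.01))))
      linarith
    have h5 : (1 - q * (1 - Real.exp (-0.01))) ^ lam
        ≤ Real.exp (lam * -(q * (1 - Real.exp (-0.01)))) := by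
      rw [Real.exp_nat_mul]
      exact pow_le_pow_left₀ h3 h4 _
    have h6 : Real.exp (-0.01) ≤ 1 / 1.01 := by
      rw [Real.exp_neg, ← one_div]
      apply one_div_le_one_div_of_le (by norm_num)
      have := Real.add_one_le_exp (0.01 : ℝ)
      linarith
    refine (mul_le_mul_of_nonneg_left h5 (by positivity)).trans ?_
    rw [← Real.exp_add]
    apply Real.exp_le_exp.2
    have h7 : 1.01 * (κ + 0.005) * μ ≤ lam * q := by nlinarith
    have h8 : (1 : ℝ) - 1 / 1.01 ≤ 1 - Real.exp (-0.01) := by linarith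
    have h9 : (0 : ℝ) ≤ lam * q :=
      mul_nonneg (by positivity) (Finset.sum_nonneg fun y _ => aux_off_nonneg _ _)
    have h10 : lam * q * (1 - 1 / 1.01) ≤ lam * q * (1 - Real.exp (-0.01)) :=
      mul_le_mul_of_nonneg_left h8 h9
    have h11 : 1.01 * (κ + 0.005) * μ * (1 - 1 / 1.01) ≤ lam * q * (1 - 1 / 1.01) :=
      mul_le_mul_of_nonneg_right h7 (by norm_num)
    have h12 : 1.01 * (κ + 0.005) * μ * (1 - 1 / 1.01) = 0.01 * (κ + 0.005) * μ := by ring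
    nlinarith

/-- transition lemma -/
theorem aux_trans {n μ lam : ℕ} (hμ : 0 < μ) (hlam : Real.exp 1 * (μ : ℝ) ≤ lam)
    (P : Fin μ → Pt n) (φ φ' : ℕ) (p α κ : ℝ) (hp : 0 ≤ p)
    (hκ : κ ≤ 1) (hα : 0 ≤ α) (hr : 1.01 * (κ + 0.005) ≤ α * p)
    (hx : ∀ x : Pt n, φ ≤ oneMax x →
      p * Real.exp (-1) ≤ ∑ y ∈ univ.filter (fun y => φ' ≤ oneMax y), mutProb n x y)
    (hP : α * μ ≤ auxGe P φ) :
    ∑ Q ∈ univ.filter (fun Q : Fin μ → Pt n => (auxGe Q φ' : ℝ) < κ * μ), stepProb n μ lam P Q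
      ≤ Real.exp (-(μ : ℝ) / 20000) := by
  have hμ' : (0 : ℝ) < μ := by exact_mod_cast hμ
  refine aux_chernoff hμ P φ' (α * p) κ hκ hr ?_
  have h1 : α * p * Real.exp (-1) ≤
      ∑ y ∈ univ.filter (fun y => φ' ≤ oneMax y), offProb n μ P y := by
    unfold offProb
    rw [← Finset.sum_div, Finset.sum_comm, le_div_iff₀ hμ']
    calc α * p * Real.exp (-1) * μ = (α * μ) * (p * Real.exp (-1)) := by ring
      _ ≤ auxGe P φ * (p * Real.exp (-1)) := mul_le_mul_of_nonneg_right hP (by positivity)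
      _ = ∑ i ∈ univ.filter (fun i => φ ≤ oneMax (P i)), (p * Real.exp (-1)) := by
        rw [Finset.sum_const, nsmul_eq_mul]; rfl
      _ ≤ ∑ i ∈ univ.filter (fun i => φ ≤ oneMax (P i)),
          ∑ y ∈ univ.filter (fun y => φ' ≤ oneMax y), mutProb n (P i) y := by
        refine Finset.sum_le_sum fun i hi => hx _ ?_
        simpa using hi
      _ ≤ _ := Finset.sum_le_sum_of_subset_of_nonneg (Finset.filter_subset _ _)
          fun i _ _ => Finset.sum_nonneg fun y _ => aux_mut_nonneg _ _
  have h2 : Real.exp 1 * Real.exp (-1) = 1 := by rw [← Real.exp_add]; simp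
  calc α * p * μ = (Real.exp 1 * μ) * (α * p * Real.exp (-1)) := by
        linear_combination -(α * p * μ) * h2
    _ ≤ lam * (α * p * Real.exp (-1)) := mul_le_mul_of_nonneg_right hlam (by positivity)
    _ ≤ _ := mul_le_mul_of_nonneg_left h1 (by positivity)

noncomputable def auxFlip {n : ℕ} (x : Pt n) (i : Fin n) : Pt n := Function.update x i (!x i)

theorem aux_mut_self {n : ℕ} (x : Pt n) : mutProb n x x = (1 - 1 / (n : ℝ)) ^ n := by
  simp [mutProb]

theorem aux_mut_flip {n : ℕ} (x : Pt n) (i : Fin n) :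
    mutProb n x (auxFlip x i) = 1 / (n : ℝ) * (1 - 1 / (n : ℝ)) ^ (n - 1) := by
  unfold mutProb
  rw [← Finset.mul_prod_erase _ _ (mem_univ i)]
  congr 1
  · simp [auxFlip]
  · rw [Finset.prod_congr rfl (g := fun _ => 1 - 1 / (n : ℝ))]
    · simp
    · intro j hj
      simp [auxFlip, Function.update_of_ne (Finset.ne_of_mem_erase hj)]

theorem aux_flip_ne {n : ℕ} (x : Pt n) (i : Fin n) : auxFlip x i ≠ x := by
  intro h
  have := congrFun h i
  simp [auxFlip] at this

theorem aux_flip_inj {n : ℕ} (x : Pt n) : Function.Injective (auxFlip x) := by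
  intro i j h
  by_contra hne
  have := congrFun h i
  simp [auxFlip, Function.update_of_ne hne] at this

theorem aux_one_flip {n : ℕ} (x : Pt n) (i : Fin n) (hi : x i = false) :
    oneMax (auxFlip x i) = oneMax x + 1 := by
  unfold oneMax
  rw [← Finset.card_insert_of_notMem (a := i) (by simp [hi])]
  congr 1
  ext j
  by_cases hj : j = i
  · subst hj; simp [auxFlip, hi]
  · simp only [mem_filter, mem_univ, true_and, mem_insert, hj, false_or]
    rw [auxFlip, Function.update_of_ne hj]

theorem aux_one_flip_ge {n : ℕ} (x : Pt n) (i : Fin n) :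
    oneMax x ≤ oneMax (auxFlip x i) + 1 := by
  unfold oneMax
  refine le_trans (Finset.card_le_card (t := insert i (univ.filter fun j => auxFlip x i j = true)) ?_)
    (Finset.card_insert_le _ _)
  intro j hj
  by_cases h : j = i
  · simp [h]
  · simp only [mem_filter, mem_univ, true_and, mem_insert, h, false_or] at hj ⊢
    rw [auxFlip, Function.update_of_ne h]
    exact hj

theorem aux_zeros {n : ℕ} (x : Pt n) :
    ((univ.filter (fun i => x i = false)).card : ℝ) = n - oneMax x := by
  have := Finset.card_filter_add_card_filter_not (s := (univ : Finset (Fin n))) (fun i => x i = true)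
  simp only [Bool.not_eq_true, card_univ, Fintype.card_fin] at this
  unfold oneMax
  rw [eq_sub_iff_add_eq]
  exact_mod_cast (by omega)

theorem aux_oneMax_le {n : ℕ} (x : Pt n) : oneMax x ≤ n := by
  unfold oneMax
  exact (Finset.card_filter_le _ _).trans (by simp)

theorem aux_e {n : ℕ} (hn : 2 ≤ n) : Real.exp (-1) ≤ (1 - 1 / (n : ℝ)) ^ (n - 1) := by
  obtain ⟨m, rfl⟩ : ∃ m, n = m + 1 := ⟨n - 1, by omega⟩
  have hm : (0 : ℝ) < m := by exact_mod_cast (by omega)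
  simp only [Nat.add_sub_cancel]
  have h : Real.exp (-1) = (Real.exp (-(1 / (m : ℝ)))) ^ m := by
    rw [← Real.exp_nat_mul]; congr 1; field_simp
  rw [h]
  refine pow_le_pow_left₀ (Real.exp_pos _).le ?_ _
  have h2 : 1 - 1 / ((m + 1 : ℕ) : ℝ) = 1 / (1 + 1 / (m : ℝ)) := by
    push_cast; field_simp; ring
  rw [h2, Real.exp_neg, ← one_div]
  apply one_div_le_one_div_of_le (by positivity)
  have := Real.add_one_le_exp (1 / (m : ℝ))
  linarith

theorem aux_mut_lower {n : ℕ} (hn : 2 ≤ n) (x : Pt n) (S : Finset (Pt n)) (I : Finset (Fin n))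
    (hI : ∀ i ∈ I, auxFlip x i ∈ S) :
    (((if x ∈ S then 1 else 0) * (1 - 1 / (n : ℝ))) + (I.card : ℝ) / n) * Real.exp (-1)
      ≤ ∑ y ∈ S, mutProb n x y := by
  have hn' : (2 : ℝ) ≤ n := by exact_mod_cast hn
  have h0 : 0 ≤ 1 - 1 / (n : ℝ) := by
    rw [sub_nonneg, div_le_one (by linarith)]; linarith
  have he := aux_e hn
  have hs : (1 - 1 / (n : ℝ)) ^ n = (1 - 1 / (n : ℝ)) * (1 - 1 / (n : ℝ)) ^ (n - 1) := by
    rw [← pow_succ']; congr 1; omega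
  have himg : ∑ y ∈ I.image (auxFlip x), mutProb n x y
      = (I.card : ℝ) / n * (1 - 1 / (n : ℝ)) ^ (n - 1) := by
    rw [Finset.sum_image (fun a _ b _ h => aux_flip_inj x h)]
    simp only [aux_mut_flip, Finset.sum_const, nsmul_eq_mul]
    ring
  have hsub : I.image (auxFlip x) ⊆ S := by
    intro y hy
    obtain ⟨i, hi, rfl⟩ := Finset.mem_image.1 hy
    exact hI i hi
  by_cases hx : x ∈ S
  · rw [if_pos hx]
    calc (1 * (1 - 1 / (n : ℝ)) + (I.card : ℝ) / n) * Real.exp (-1)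
        ≤ (1 * (1 - 1 / (n : ℝ)) + (I.card : ℝ) / n) * (1 - 1 / (n : ℝ)) ^ (n - 1) :=
          mul_le_mul_of_nonneg_left he (by positivity)
      _ = ∑ y ∈ insert x (I.image (auxFlip x)), mutProb n x y := by
          rw [Finset.sum_insert, himg, aux_mut_self, hs]
          · ring
          · intro h
            obtain ⟨i, _, h⟩ := Finset.mem_image.1 h
            exact aux_flip_ne x i h
      _ ≤ _ := Finset.sum_le_sum_of_subset_of_nonneg
          (Finset.insert_subset hx hsub) fun y _ _ => aux_mut_nonneg _ _
  · rw [if_neg hx]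
    calc (0 * (1 - 1 / (n : ℝ)) + (I.card : ℝ) / n) * Real.exp (-1)
        ≤ (0 * (1 - 1 / (n : ℝ)) + (I.card : ℝ) / n) * (1 - 1 / (n : ℝ)) ^ (n - 1) :=
          mul_le_mul_of_nonneg_left he (by positivity)
      _ = ∑ y ∈ I.image (auxFlip x), mutProb n x y := by rw [himg]; ring
      _ ≤ _ := Finset.sum_le_sum_of_subset_of_nonneg hsub fun y _ _ => aux_mut_nonneg _ _

theorem aux_inv {n : ℕ} (hn : 1000 ≤ n) : 1 / (n : ℝ) ≤ 0.001 := by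
  have hn' : (1000 : ℝ) ≤ n := by exact_mod_cast hn
  rw [div_le_iff₀ (by linarith)]
  linarith

theorem aux_T0 {n : ℕ} (hn : 1000 ≤ n) (φ : ℕ) (x : Pt n) (hx : φ ≤ oneMax x) :
    0.9 * Real.exp (-1) ≤ ∑ y ∈ univ.filter (fun y => φ ≤ oneMax y), mutProb n x y := by
  have h := aux_mut_lower (by omega) x (univ.filter (fun y => φ ≤ oneMax y)) ∅ (by simp)
  rw [if_pos (by simpa using hx)] at h
  refine le_trans (mul_le_mul_of_nonneg_right ?_ (Real.exp_pos _).le) h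
  have := aux_inv hn
  simp only [Finset.card_empty, Nat.cast_zero, zero_div]
  linarith

theorem aux_T1 {n : ℕ} (hn : 1000 ≤ n) (φ : ℕ) (hφ : (φ : ℝ) ≤ n / 3) (x : Pt n)
    (hx : φ ≤ oneMax x) :
    0.66 * Real.exp (-1) ≤ ∑ y ∈ univ.filter (fun y => φ + 1 ≤ oneMax y), mutProb n x y := by
  have hn' : (1000 : ℝ) ≤ n := by exact_mod_cast hn
  rcases hx.eq_or_lt with h | h
  · have h1 := aux_mut_lower (by omega) x (univ.filter (fun y => φ + 1 ≤ oneMax y))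
      (univ.filter (fun i => x i = false)) (by
        intro i hi
        simp only [mem_filter, mem_univ, true_and] at hi ⊢
        rw [aux_one_flip x i hi]; omega)
    rw [if_neg (by simp; omega), aux_zeros, ← h] at h1
    refine le_trans (mul_le_mul_of_nonneg_right ?_ (Real.exp_pos _).le) h1
    rw [zero_mul, zero_add, le_div_iff₀ (by linarith)]
    linarith
  · refine le_trans (mul_le_mul_of_nonneg_right ?_ (Real.exp_pos _).le) (aux_T0 hn (φ + 1) x h)
    norm_num

theorem aux_T2 {n : ℕ} (hn : 1000 ≤ n) (φ : ℕ) (hφ : (φ : ℝ) ≤ n / 3 + 1) (x : Pt n)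
    (hx : φ ≤ oneMax x) :
    1.66 * Real.exp (-1) ≤ ∑ y ∈ univ.filter (fun y => φ ≤ oneMax y), mutProb n x y := by
  have hn' : (1000 : ℝ) ≤ n := by exact_mod_cast hn
  have hinv := aux_inv hn
  rcases hx.eq_or_lt with h | h
  · have h1 := aux_mut_lower (by omega) x (univ.filter (fun y => φ ≤ oneMax y))
      (univ.filter (fun i => x i = false)) (by
        intro i hi
        simp only [mem_filter, mem_univ, true_and] at hi ⊢
        rw [aux_one_flip x i hi]; omega)
    rw [if_pos (by simpa using hx), aux_zeros, ← h] at h1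
    refine le_trans (mul_le_mul_of_nonneg_right ?_ (Real.exp_pos _).le) h1
    have : (0.665 : ℝ) ≤ (n - φ) / n := by
      rw [le_div_iff₀ (by linarith)]
      linarith
    linarith
  · have h1 := aux_mut_lower (by omega) x (univ.filter (fun y => φ ≤ oneMax y))
      univ (by
        intro i hi
        simp only [mem_filter, mem_univ, true_and] at hi ⊢
        have := aux_one_flip_ge x i
        omega)
    rw [if_pos (by simpa using hx)] at h1
    refine le_trans (mul_le_mul_of_nonneg_right ?_ (Real.exp_pos _).le) h1
    simp only [card_univ, Fintype.card_fin]
    rw [div_self (by linarith)]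
    linarith

/-- success in one step -/
def auxG {n μ : ℕ} (P Q : Fin μ → Pt n) : Prop :=
  ∃ φ : ℕ, (n : ℝ) / 3 < φ ∧ (μ : ℝ) / 2 ≤ auxGe P φ ∧ (cntGt P φ : ℝ) < μ / 2 ∧
    (μ : ℝ) / 4 ≤ auxGe Q φ ∧ (cntGt Q φ : ℝ) < μ / 2

noncomputable def auxM (n μ lam : ℕ) (P Q : Fin μ → Pt n) : ℝ :=
  if auxG P Q then 0 else stepProb n μ lam P Q

noncomputable def auxV (n μ lam : ℕ) : ℕ → (Fin μ → Pt n) → ℝ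
  | 0 => fun _ => 1
  | t + 1 => fun P => ∑ Q, auxM n μ lam P Q * auxV n μ lam t Q

theorem auxM_nonneg {n μ lam : ℕ} (P Q : Fin μ → Pt n) : 0 ≤ auxM n μ lam P Q := by
  unfold auxM; split_ifs
  · exact le_rfl
  · exact aux_step_nonneg _ _

theorem auxM_le {n μ lam : ℕ} (P Q : Fin μ → Pt n) : auxM n μ lam P Q ≤ stepProb n μ lam P Q := by
  unfold auxM; split_ifs
  · exact aux_step_nonneg _ _
  · exact le_rfl

theorem auxM_sum {n μ lam : ℕ} (hμ : 0 < μ) (P : Fin μ → Pt n) : ∑ Q, auxM n μ lam P Q ≤ 1 :=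
  (Finset.sum_le_sum fun Q _ => auxM_le P Q).trans (aux_step_sum hμ P)

theorem auxV_nonneg {n μ lam : ℕ} (t : ℕ) : ∀ P, 0 ≤ auxV n μ lam t P := by
  induction t with
  | zero => intro P; simp [auxV]
  | succ t ih => intro P; exact Finset.sum_nonneg fun Q _ => mul_nonneg (auxM_nonneg _ _) (ih Q)

theorem auxV_anti {n μ lam : ℕ} (hμ : 0 < μ) (t : ℕ) :
    ∀ P, auxV n μ lam (t + 1) P ≤ auxV n μ lam t P := by
  induction t with
  | zero => intro P; simpa [auxV] using auxM_sum hμ P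
  | succ t ih =>
    intro P
    exact Finset.sum_le_sum fun Q _ => mul_le_mul_of_nonneg_left (ih Q) (auxM_nonneg _ _)

theorem auxV_antitone {n μ lam : ℕ} (hμ : 0 < μ) (P) :
    Antitone (fun t => auxV n μ lam t P) := antitone_nat_of_succ_le fun t => auxV_anti hμ t P

theorem auxV_le_one {n μ lam : ℕ} (hμ : 0 < μ) (t : ℕ) (P) : auxV n μ lam t P ≤ 1 :=
  auxV_antitone hμ P (Nat.zero_le t)

theorem auxV_mul {n μ lam : ℕ} (K : ℕ) (b : ℝ) (hb : 0 ≤ b)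
    (hK : ∀ P, auxV n μ lam K P ≤ b) (t : ℕ) :
    ∀ P, auxV n μ lam (t + K) P ≤ b * auxV n μ lam t P := by
  induction t with
  | zero => intro P; simpa [auxV] using hK P
  | succ t ih =>
    intro P
    rw [show t + 1 + K = (t + K) + 1 by omega]
    simp only [auxV]
    rw [Finset.mul_sum]
    refine Finset.sum_le_sum fun Q _ => ?_
    calc _ ≤ auxM n μ lam P Q * (b * auxV n μ lam t Q) :=
          mul_le_mul_of_nonneg_left (ih Q) (auxM_nonneg _ _)
      _ = _ := by ring

theorem aux_one_step {n μ lam : ℕ} (hμ : 0 < μ) (t : ℕ) (P : Fin μ → Pt n)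
    (bad : (Fin μ → Pt n) → Prop) (ε β : ℝ) (hβ : 0 ≤ β)
    (hbad : ∑ Q ∈ univ.filter bad, stepProb n μ lam P Q ≤ ε)
    (hgood : ∀ Q, ¬ bad Q → ¬ auxG P Q → auxV n μ lam t Q ≤ β) :
    auxV n μ lam (t + 1) P ≤ ε + β := by
  simp only [auxV]
  rw [← Finset.sum_filter_add_sum_filter_not univ bad]
  refine add_le_add (le_trans (Finset.sum_le_sum fun Q _ => ?_) hbad) ?_
  · calc _ ≤ auxM n μ lam P Q * 1 :=
        mul_le_mul_of_nonneg_left (auxV_le_one hμ _ _) (auxM_nonneg _ _)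
      _ ≤ _ := by rw [mul_one]; exact auxM_le P Q
  · calc _ ≤ ∑ Q ∈ univ.filter (fun Q => ¬ bad Q), auxM n μ lam P Q * β := by
          refine Finset.sum_le_sum fun Q hQ => ?_
          simp only [mem_filter, mem_univ, true_and] at hQ
          by_cases hG : auxG P Q
          · simp [auxM, hG]
          · exact mul_le_mul_of_nonneg_left (hgood Q hQ hG) (auxM_nonneg _ _)
      _ ≤ ∑ Q, auxM n μ lam P Q * β :=
          Finset.sum_le_sum_of_subset_of_nonneg (Finset.filter_subset _ _)
            fun Q _ _ => mul_nonneg (auxM_nonneg _ _) hβ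
      _ ≤ β := by
          rw [← Finset.sum_mul]
          exact mul_le_of_le_one_left hβ (auxM_sum hμ P)

theorem aux_gt_top {n μ : ℕ} (P : Fin μ → Pt n) : cntGt P n = 0 := by
  unfold cntGt
  rw [Finset.card_eq_zero, Finset.filter_eq_empty_iff]
  intro i _
  have := aux_oneMax_le (P i)
  omega

theorem aux_main {n μ lam : ℕ} (hn : 1000 ≤ n) (hμ : 0 < μ)
    (hlam : Real.exp 1 * (μ : ℝ) ≤ lam) (d : ℕ) :
    ∀ (φ : ℕ) (_ : φ + d = n) (P : Fin μ → Pt n) (_ : (μ : ℝ) / 2 ≤ auxGe P φ),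
      auxV n μ lam (2 * (d + 1)) P ≤ 2 * (d + 1) * Real.exp (-(μ : ℝ) / 20000) := by
  have hμ' : (0 : ℝ) < μ := by exact_mod_cast hμ
  have hn' : (1000 : ℝ) ≤ n := by exact_mod_cast hn
  set ε := Real.exp (-(μ : ℝ) / 20000) with hε
  have hε0 : 0 < ε := Real.exp_pos _
  induction d with
  | zero =>
    intro φ hφ P hP
    obtain rfl : φ = n := by omega
    refine (auxV_anti hμ 1 P).trans ?_
    refine (aux_one_step hμ 0 P (fun Q => (auxGe Q φ : ℝ) < 1 / 4 * μ) ε 0 le_rfl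
      (aux_trans hμ hlam P φ φ 0.9 (1 / 2) (1 / 4) (by norm_num) (by norm_num) (by norm_num)
        (by norm_num) (aux_T0 hn φ) (by linarith)) ?_).trans (by push_cast; linarith)
    intro Q hQ hG
    exfalso
    apply hG
    refine ⟨φ, by linarith, hP, ?_, by linarith, ?_⟩ <;>
    · rw [aux_gt_top]; simpa using hμ
  | succ d ih =>
    intro φ hφ P hP
    push_cast
    have hIH := ih (φ + 1) (by omega)
    have hβ : 0 ≤ 2 * ((d : ℝ) + 1) * ε := by positivity
    by_cases hlow : (φ : ℝ) ≤ n / 3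
    · have hA : auxV n μ lam (2 * (d + 1) + 1 + 1) P ≤ ε + (ε + 2 * ((d : ℝ) + 1) * ε) := by
        refine aux_one_step hμ _ P (fun Q => (auxGe Q (φ + 1) : ℝ) < 0.31 * μ) ε _ (by positivity)
          (aux_trans hμ hlam P φ (φ + 1) 0.66 (1 / 2) 0.31 (by norm_num) (by norm_num)
            (by norm_num) (by norm_num) (aux_T1 hn φ hlow) (by linarith)) ?_
        intro Q hQ _
        refine aux_one_step hμ _ Q (fun R => (auxGe R (φ + 1) : ℝ) < 1 / 2 * μ) ε _ hβ
          (aux_trans hμ hlam Q (φ + 1) (φ + 1) 1.66 0.31 (1 / 2) (by norm_num) (by norm_num)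
            (by norm_num) (by norm_num) (aux_T2 hn (φ + 1) (by push_cast; linarith))
            (by linarith)) ?_
        intro R hR _
        exact hIH R (by linarith)
      refine (le_of_eq ?_).trans (hA.trans (le_of_eq ?_))
      · congr 1
      · ring
    · push Not at hlow
      by_cases hgt : (μ : ℝ) / 2 ≤ cntGt P φ
      · refine (auxV_antitone hμ P (show 2 * (d + 1) ≤ 2 * (d + 1 + 1) by omega)).trans ?_
        refine (hIH P hgt).trans ?_
        nlinarith
      · push Not at hgt
        refine (auxV_antitone hμ P (show 2 * (d + 1) + 1 ≤ 2 * (d + 1 + 1) by omega)).trans ?_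
        refine (aux_one_step hμ _ P (fun Q => (auxGe Q φ : ℝ) < 1 / 4 * μ) ε _ hβ
          (aux_trans hμ hlam P φ φ 0.9 (1 / 2) (1 / 4) (by norm_num) (by norm_num) (by norm_num)
            (by norm_num) (aux_T0 hn φ) (by linarith)) ?_).trans (by linarith)
        intro Q hQ hG
        refine hIH Q ?_
        rw [auxGe_succ]
        by_contra hc
        push Not at hc
        exact hG ⟨φ, hlow, hP, hgt, by linarith, hc⟩

theorem aux_start {n μ lam : ℕ} (hn : 1000 ≤ n) (hμ : 0 < μ)
    (hlam : Real.exp 1 * (μ : ℝ) ≤ lam) (P : Fin μ → Pt n) :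
    auxV n μ lam (2 * (n + 1)) P ≤ 2 * (n + 1) * Real.exp (-(μ : ℝ) / 20000) := by
  refine aux_main hn hμ hlam n 0 (by omega) P ?_
  have : auxGe P 0 = μ := by simp [auxGe]
  rw [this]
  have : (0 : ℝ) ≤ μ := by positivity
  linarith

theorem aux_surv {n μ lam : ℕ} (t : ℕ) (b : ℝ)
    (hb : ∀ P, auxV n μ lam t P ≤ b) : survLevelThird n μ lam t ≤ b := by
  have h1 : survLevelThird n μ lam t ≤ ∑ path : Fin (t + 1) → Fin μ → Pt n,
      ((1 : ℝ) / 2 ^ n) ^ μ * ∏ s : Fin t, auxM n μ lam (path s.castSucc) (path s.succ) := by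
    unfold survLevelThird
    rw [Finset.sum_filter]
    refine Finset.sum_le_sum fun path _ => ?_
    split_ifs with h
    · unfold pathProb
      refine le_of_eq ?_
      congr 1
      refine Finset.prod_congr rfl fun s _ => ?_
      unfold auxM
      rw [if_neg]
      rintro ⟨φ, h1, h2, h3, h4, h5⟩
      refine h s.succ ⟨φ, h1, s.val, by simp, ?_⟩
      have e1 : (if hu : s.val < t + 1 then path ⟨s.val, hu⟩ else path (Fin.last t))
          = path s.castSucc := by
        rw [dif_pos (by omega)]; rfl
      have e2 : (if hu : s.val + 1 < t + 1 then path ⟨s.val + 1, hu⟩ else path (Fin.last t))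
          = path s.succ := by
        rw [dif_pos (by omega)]; rfl
      have hμ0 : (0 : ℝ) ≤ μ := by positivity
      simp only [auxGe_eq]
      refine ⟨by rw [e1]; exact h2, ?_⟩
      intro τ ha hc
      rw [Fin.val_succ] at hc
      obtain rfl | rfl : τ = s.val ∨ τ = s.val + 1 := by omega
      · rw [e1]; exact ⟨by linarith, h3⟩
      · rw [e2]; exact ⟨h4, h5⟩
    · exact mul_nonneg (by positivity) (Finset.prod_nonneg fun s _ => auxM_nonneg _ _)
  refine h1.trans ?_
  rw [aux_pathSum (auxM n μ lam) (auxV n μ lam) (fun _ => rfl) (fun _ _ => rfl) t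
    (fun _ => ((1 : ℝ) / 2 ^ n) ^ μ)]
  refine (Finset.sum_le_sum fun P _ => mul_le_mul_of_nonneg_left (hb P) (by positivity)).trans ?_
  rw [Finset.sum_const, nsmul_eq_mul]
  have : (((univ : Finset (Fin μ → Pt n)).card : ℕ) : ℝ) * ((1 : ℝ) / 2 ^ n) ^ μ = 1 := by
    simp
  rw [← mul_assoc, this, one_mul]

theorem aux_geom {n μ lam : ℕ} (hμ : 0 < μ) (K : ℕ)
    (hK : ∀ P, auxV n μ lam K P ≤ 1 / 2) (j : ℕ) :
    ∀ r P, auxV n μ lam (r + K * j) P ≤ (1 / 2) ^ j := by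
  induction j with
  | zero => intro r P; simpa using auxV_le_one hμ _ _
  | succ j ih =>
    intro r P
    rw [show r + K * (j + 1) = (r + K * j) + K by ring]
    refine (auxV_mul K (1 / 2) (by norm_num) hK _ P).trans ?_
    rw [pow_succ']
    exact mul_le_mul_of_nonneg_left (ih r P) (by norm_num)

theorem aux_tsum (f : ℕ → ℝ≥0∞) (K : ℕ) (hK : 0 < K)
    (h : ∀ j r, f (r + K * j) ≤ ENNReal.ofReal ((1 / 2) ^ j)) :
    ∑' t, f t ≤ ENNReal.ofReal (2 * K) := by
  have : NeZero K := ⟨hK.ne'⟩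
  rw [← (Nat.divModEquiv K).symm.tsum_eq f, ENNReal.tsum_prod (f := fun a b => f ((Nat.divModEquiv K).symm (a, b)))]
  have hg : ∑' j : ℕ, ENNReal.ofReal ((1 / 2 : ℝ) ^ j) = ENNReal.ofReal 2 := by
    rw [← ENNReal.ofReal_tsum_of_nonneg (fun j => by positivity) summable_geometric_two,
      tsum_geometric_two]
  calc ∑' (a : ℕ) (b : Fin K), f ((Nat.divModEquiv K).symm (a, b))
      ≤ ∑' (a : ℕ), (K : ℝ≥0∞) * ENNReal.ofReal ((1 / 2 : ℝ) ^ a) := by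
        refine ENNReal.tsum_le_tsum fun a => ?_
        rw [tsum_fintype]
        refine (Finset.sum_le_sum (g := fun _ => ENNReal.ofReal ((1 / 2 : ℝ) ^ a))
          fun b _ => ?_).trans (by simp)
        have := h a b.val
        refine le_trans (le_of_eq ?_) this
        congr 1
        simp [Nat.divModEquiv]
        ring
    _ = ENNReal.ofReal (2 * K) := by
        rw [ENNReal.tsum_mul_left, hg, ENNReal.ofReal_mul (by norm_num), ENNReal.ofReal_natCast,
          mul_comm]

theorem aux_large : ∃ n₀ : ℕ, ∀ n ≥ n₀, ∀ m : ℝ,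
    (n : ℝ) ^ ((2 : ℝ) / 3) * (Real.log (n : ℝ)) ^ 4 ≤ m →
      2 * ((n : ℝ) + 1) * Real.exp (-m / 20000) ≤ 1 / 2 := by
  have h1 : Filter.Tendsto (fun n : ℕ => Real.log (n : ℝ)) Filter.atTop Filter.atTop :=
    Real.tendsto_log_atTop.comp tendsto_natCast_atTop_atTop
  obtain ⟨N, hN⟩ := Filter.eventually_atTop.1 (h1.eventually_ge_atTop 40000)
  refine ⟨max N 8, fun n hn m hm => ?_⟩
  have hl := hN n (le_trans (le_max_left _ _) hn)
  have hn8 : (8 : ℝ) ≤ n := by exact_mod_cast le_trans (le_max_right _ _) hn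
  have hp : (1 : ℝ) ≤ (n : ℝ) ^ ((2 : ℝ) / 3) := Real.one_le_rpow (by linarith) (by norm_num)
  set l := Real.log (n : ℝ) with hldef
  have hl4 : 40000 * l ≤ l ^ 4 := by
    have : (40000 : ℝ) ≤ l ^ 3 := by
      calc (40000 : ℝ) ≤ l := hl
        _ = l ^ 1 := by ring
        _ ≤ l ^ 3 := pow_le_pow_right₀ (by linarith) (by norm_num)
    calc 40000 * l ≤ l ^ 3 * l := mul_le_mul_of_nonneg_right this (by linarith)
      _ = l ^ 4 := by ring
  have hm2 : 40000 * l ≤ m := by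
    refine hl4.trans (le_trans ?_ hm)
    exact le_mul_of_one_le_left (by positivity) hp
  have he : Real.exp (-m / 20000) ≤ 1 / (n : ℝ) ^ 2 := by
    have : Real.exp (-(l + l)) = 1 / (n : ℝ) ^ 2 := by
      rw [Real.exp_neg, Real.exp_add, hldef, Real.exp_log (by linarith), one_div, sq]
    rw [← this]
    apply Real.exp_le_exp.2
    linarith
  calc 2 * ((n : ℝ) + 1) * Real.exp (-m / 20000) ≤ 2 * ((n : ℝ) + 1) * (1 / (n : ℝ) ^ 2) :=
        mul_le_mul_of_nonneg_left he (by positivity)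
    _ ≤ 1 / 2 := by
        rw [mul_one_div, div_le_iff₀ (by positivity)]
        nlinarith

/-- If `λ(n) ≥ e μ(n)` and `μ(n) ≥ n^{2/3} (ln n)^4`, then there is a
constant `C` such that for all sufficiently large `n` the expected number of
generations of the (μ,λ) EA on OneMax until the current level first exceeds `n/3` is
at most `C·n`. -/
theorem stmt17 (μ lam : ℕ → ℕ) (hμpos : ∀ n, 0 < μ n)
    (hlam : ∀ n, Real.exp 1 * (μ n : ℝ) ≤ (lam n : ℝ))
    (hμlb : ∀ n : ℕ, (n : ℝ) ^ ((2 : ℝ) / 3) * (Real.log (n : ℝ)) ^ 4 ≤ (μ n : ℝ)) :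
    ∃ C : ℝ, ∃ n₀ : ℕ, ∀ n ≥ n₀,
      (∑' t : ℕ, ENNReal.ofReal (survLevelThird n (μ n) (lam n) t))
        ≤ ENNReal.ofReal (C * (n : ℝ)) := by
  obtain ⟨n₀, h₀⟩ := aux_large
  refine ⟨8, max n₀ 1000, fun n hn => ?_⟩
  have hn1 : 1000 ≤ n := le_trans (le_max_right _ _) hn
  have hn1' : (1000 : ℝ) ≤ n := by exact_mod_cast hn1
  have hhalf := h₀ n (le_trans (le_max_left _ _) hn) (μ n) (hμlb n)
  have hK : ∀ P, auxV n (μ n) (lam n) (2 * (n + 1)) P ≤ 1 / 2 := fun P =>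
    (aux_start hn1 (hμpos n) (hlam n) P).trans hhalf
  refine (aux_tsum _ (2 * (n + 1)) (by omega) fun j r =>
    ENNReal.ofReal_le_ofReal (aux_surv _ _ (aux_geom (hμpos n) _ hK j r))).trans ?_
  apply ENNReal.ofReal_le_ofReal
  push_cast
  linarith
end

section
/- Consider the (μ,λ) EA on the n-dimensional OneMax function with λ ≥ e·μ, λ/μ bounded by a polynomial in n, and μ = n^{2/3}·h(n) where h(n) ≥ (ln n)^4. Suppose the current level is some f with n/3 < f < n. If n is large enough, then the expected number of generations until the algorithm either loses or gains a level is at most 8n/(n − f), and the probability that this results in a level loss (rather than a level gain) is at most 10/n. -/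
open Finset
open scoped ENNReal

attribute [local instance] Classical.propDecidable

/-! ### Path recursion -/

noncomputable def actPr (n μ lam : ℕ) (A : (Fin μ → Pt n) → Prop) (P : Fin μ → Pt n) (t : ℕ) : ℝ :=
  prEvent n μ lam P t (fun path => ∀ s : Fin (t + 1), A (path s))

noncomputable def lossPr (n μ lam : ℕ) (A B : (Fin μ → Pt n) → Prop) (P : Fin μ → Pt n) (t : ℕ) :
    ℝ :=
  prEvent n μ lam P t (fun path => (∀ s : Fin (t + 1), (s : ℕ) < t → A (path s)) ∧
    B (path (Fin.last t)))

lemma prEvent_zero (n μ lam : ℕ) (P : Fin μ → Pt n) (good : (Fin 1 → Fin μ → Pt n) → Prop) :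
    prEvent n μ lam P 0 good = if good (fun _ => P) then 1 else 0 := by
  unfold prEvent
  simp only [Nat.reduceAdd, univ_eq_empty, prod_empty, sum_const, nsmul_eq_mul, mul_one]
  split_ifs with hg
  · have : (univ.filter (fun path : Fin 1 → Fin μ → Pt n => path 0 = P ∧ good path))
        = {fun _ => P} := by
      ext path
      simp only [mem_filter, mem_univ, true_and, mem_singleton]
      constructor
      · rintro ⟨h, -⟩
        funext s
        rw [Subsingleton.elim s 0, h]
      · rintro rfl
        exact ⟨rfl, hg⟩
    rw [this]; simp
  · have : (univ.filter (fun path : Fin 1 → Fin μ → Pt n => path 0 = P ∧ good path)) = ∅ := by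
      ext path
      simp only [mem_filter, mem_univ, true_and, notMem_empty, iff_false]
      rintro ⟨h, h2⟩
      apply hg
      have : path = fun _ => P := by
        funext s
        rw [Subsingleton.elim s 0, h]
      rwa [← this]
    rw [this]; simp

lemma prEvent_succ (n μ lam : ℕ) (P : Fin μ → Pt n) (t : ℕ)
    (good : (Fin (t + 1 + 1) → Fin μ → Pt n) → Prop) :
    prEvent n μ lam P (t + 1) good =
      ∑ Q, stepProb n μ lam P Q * prEvent n μ lam Q t (fun path => good (Fin.cons P path)) := by
  unfold prEvent
  simp only [Finset.sum_filter, Finset.mul_sum]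
  rw [Finset.sum_comm]
  rw [← (Fin.consEquiv (fun _ : Fin (t + 1 + 1) => Fin μ → Pt n)).sum_comp]
  rw [Fintype.sum_prod_type]
  rw [Finset.sum_eq_single P]
  · refine Finset.sum_congr rfl fun path _ => ?_
    rw [Finset.sum_eq_single (path 0)]
    · by_cases hg : good (Fin.cons P path)
      · simp [Fin.consEquiv, hg, Fin.prod_univ_succ]
      · simp [Fin.consEquiv, hg]
    · intro Q _ hQ
      rw [if_neg, mul_zero]
      rintro ⟨h, -⟩
      exact hQ h.symm
    · simp
  · intro Q _ hQ
    refine Finset.sum_eq_zero fun path _ => ?_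
    rw [if_neg]
    rintro ⟨h, -⟩
    exact hQ (by simpa [Fin.consEquiv] using h)
  · simp

lemma prEvent_false (n μ lam : ℕ) (P : Fin μ → Pt n) (t : ℕ)
    (good : (Fin (t + 1) → Fin μ → Pt n) → Prop) (h : ∀ path, path 0 = P → ¬ good path) :
    prEvent n μ lam P t good = 0 := by
  unfold prEvent
  rw [Finset.filter_false_of_mem]
  · simp
  · rintro path - ⟨h1, h2⟩
    exact h path h1 h2

lemma actPr_zero (n μ lam : ℕ) (A : (Fin μ → Pt n) → Prop) (P : Fin μ → Pt n) :
    actPr n μ lam A P 0 = if A P then 1 else 0 := by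
  unfold actPr
  rw [prEvent_zero]
  simp

lemma actPr_neg (n μ lam : ℕ) (A : (Fin μ → Pt n) → Prop) (P : Fin μ → Pt n) (hA : ¬ A P) (t : ℕ) :
    actPr n μ lam A P t = 0 := by
  unfold actPr
  apply prEvent_false
  intro path h0 h
  exact hA (h0 ▸ h 0)

lemma actPr_succ (n μ lam : ℕ) (A : (Fin μ → Pt n) → Prop) (P : Fin μ → Pt n) (hA : A P) (t : ℕ) :
    actPr n μ lam A P (t + 1) = ∑ Q, stepProb n μ lam P Q * actPr n μ lam A Q t := by
  unfold actPr
  rw [prEvent_succ]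
  refine Finset.sum_congr rfl fun Q _ => ?_
  congr 2
  funext path
  rw [Fin.forall_fin_succ]
  simp [hA]

lemma lossPr_zero (n μ lam : ℕ) (A B : (Fin μ → Pt n) → Prop) (P : Fin μ → Pt n) :
    lossPr n μ lam A B P 0 = if B P then 1 else 0 := by
  unfold lossPr
  rw [prEvent_zero]
  simp

lemma lossPr_neg (n μ lam : ℕ) (A B : (Fin μ → Pt n) → Prop) (P : Fin μ → Pt n) (hA : ¬ A P)
    (t : ℕ) : lossPr n μ lam A B P (t + 1) = 0 := by
  unfold lossPr
  apply prEvent_false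
  intro path h0 h
  exact hA (h0 ▸ h.1 0 (by simp))

lemma lossPr_succ (n μ lam : ℕ) (A B : (Fin μ → Pt n) → Prop) (P : Fin μ → Pt n) (hA : A P)
    (t : ℕ) :
    lossPr n μ lam A B P (t + 1) = ∑ Q, stepProb n μ lam P Q * lossPr n μ lam A B Q t := by
  unfold lossPr
  rw [prEvent_succ]
  refine Finset.sum_congr rfl fun Q _ => ?_
  congr 2
  funext path
  rw [Fin.forall_fin_succ]
  simp [hA, ← Fin.succ_last]

lemma tsum_ofReal_le (a : ℕ → ℝ) (ha : ∀ t, 0 ≤ a t) (C : ℝ)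
    (h : ∀ N, ∑ t ∈ range N, a t ≤ C) :
    (∑' t, ENNReal.ofReal (a t)) ≤ ENNReal.ofReal C := by
  rw [ENNReal.tsum_eq_iSup_nat]
  refine iSup_le fun N => ?_
  rw [← ENNReal.ofReal_sum_of_nonneg (fun i _ => ha i)]
  exact ENNReal.ofReal_le_ofReal (h N)

lemma act_sum_le (n μ lam : ℕ) (hst : ∀ P Q, 0 ≤ stepProb n μ lam P Q)
    (A : (Fin μ → Pt n) → Prop) (H : (Fin μ → Pt n) → ℝ) (d : ℝ)
    (hH : ∀ P, 0 ≤ H P) (hd : 0 < d)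
    (hdr : ∀ P, A P → ∑ Q, stepProb n μ lam P Q * H Q ≤ H P - d) (N : ℕ) :
    ∀ P, ∑ t ∈ range N, actPr n μ lam A P t ≤ H P / d := by
  induction N with
  | zero => intro P; simpa using div_nonneg (hH P) hd.le
  | succ N ih =>
    intro P
    by_cases hA : A P
    · rw [Finset.sum_range_succ', actPr_zero, if_pos hA]
      simp_rw [actPr_succ n μ lam A P hA]
      rw [Finset.sum_comm]
      simp_rw [← Finset.mul_sum]
      have h1 : ∑ Q, stepProb n μ lam P Q * ∑ t ∈ range N, actPr n μ lam A Q t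
          ≤ ∑ Q, stepProb n μ lam P Q * (H Q / d) :=
        Finset.sum_le_sum fun Q _ => mul_le_mul_of_nonneg_left (ih Q) (hst P Q)
      have h2 : ∑ Q, stepProb n μ lam P Q * (H Q / d)
          = (∑ Q, stepProb n μ lam P Q * H Q) / d := by
        rw [Finset.sum_div]
        exact Finset.sum_congr rfl fun Q _ => by ring
      have h3 : (∑ Q, stepProb n μ lam P Q * H Q) / d ≤ (H P - d) / d := by
        gcongr
        exact hdr P hA
      have h4 : (H P - d) / d + 1 = H P / d := by field_simp; ring
      linarith
    · rw [Finset.sum_eq_zero fun t _ => actPr_neg n μ lam A P hA t]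
      exact div_nonneg (hH P) hd.le

lemma loss_sum_le (n μ lam : ℕ) (hst : ∀ P Q, 0 ≤ stepProb n μ lam P Q)
    (A B : (Fin μ → Pt n) → Prop) (W : (Fin μ → Pt n) → ℝ)
    (hW : ∀ P, 0 ≤ W P) (hB : ∀ P, B P → 1 ≤ W P) (hAB : ∀ P, A P → ¬ B P)
    (hdr : ∀ P, A P → ∑ Q, stepProb n μ lam P Q * W Q ≤ W P) (N : ℕ) :
    ∀ P, ∑ t ∈ range N, lossPr n μ lam A B P t ≤ W P := by
  induction N with
  | zero => intro P; simpa using hW P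
  | succ N ih =>
    intro P
    rw [Finset.sum_range_succ', lossPr_zero]
    by_cases hA : A P
    · rw [if_neg (hAB P hA)]
      simp_rw [lossPr_succ n μ lam A B P hA]
      rw [Finset.sum_comm]
      simp_rw [← Finset.mul_sum]
      have h1 : ∑ Q, stepProb n μ lam P Q * ∑ t ∈ range N, lossPr n μ lam A B Q t
          ≤ ∑ Q, stepProb n μ lam P Q * W Q :=
        Finset.sum_le_sum fun Q _ => mul_le_mul_of_nonneg_left (ih Q) (hst P Q)
      linarith [hdr P hA]
    · rw [Finset.sum_eq_zero fun t _ => lossPr_neg n μ lam A B P hA t]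
      split_ifs with h
      · simpa using hB P h
      · simpa using hW P

lemma prEvent_nonneg (n μ lam : ℕ) (hst : ∀ P Q, 0 ≤ stepProb n μ lam P Q)
    (P : Fin μ → Pt n) (t : ℕ) (good : (Fin (t + 1) → Fin μ → Pt n) → Prop) :
    0 ≤ prEvent n μ lam P t good :=
  Finset.sum_nonneg fun _ _ => Finset.prod_nonneg fun _ _ => hst _ _

/-! ### Selection -/

noncomputable def cge {n m : ℕ} (P : Fin m → Pt n) (φ : ℕ) : ℕ :=
  (univ.filter (fun i => φ ≤ oneMax (P i))).card

lemma cntGt_eq {n m : ℕ} (P : Fin m → Pt n) (φ : ℕ) : cntGt P φ = cge P (φ + 1) := rfl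

lemma cntEq_add {n m : ℕ} (P : Fin m → Pt n) (φ : ℕ) : cntEq P φ + cntGt P φ = cge P φ := by
  unfold cntEq cntGt cge
  rw [← Finset.card_union_of_disjoint]
  · congr 1
    ext i
    simp only [mem_union, mem_filter, mem_univ, true_and]
    omega
  · rw [Finset.disjoint_filter]
    intro i _ h
    omega

lemma cge_le {n m : ℕ} (P : Fin m → Pt n) (φ : ℕ) : cge P φ ≤ m := by
  unfold cge
  simpa using Finset.card_filter_le (univ : Finset (Fin m)) (fun i => φ ≤ oneMax (P i))

lemma cge_anti {n m : ℕ} (P : Fin m → Pt n) (φ : ℕ) : cge P (φ + 1) ≤ cge P φ := by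
  have := cntEq_add P φ
  rw [cntGt_eq] at this; omega

lemma sel_ge {n μ lam : ℕ} (o : Fin lam → Pt n) (s : Fin μ → Fin lam) (hs : validSel o s)
    (φ : ℕ) : min (cge o φ) μ ≤ cge (o ∘ s) φ := by
  by_cases hall : ∀ i, φ ≤ oneMax (o (s i))
  · refine (min_le_right _ _).trans ?_
    unfold cge
    have : (univ.filter (fun i => φ ≤ oneMax ((o ∘ s) i))) = univ :=
      Finset.filter_true_of_mem (fun i _ => hall i)
    rw [this]
    simp
  · push Not at hall
    obtain ⟨i, hi⟩ := hall
    refine (min_le_left _ _).trans ?_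
    unfold cge
    have : univ.filter (fun j => φ ≤ oneMax (o j)) ⊆
        (univ.filter (fun i => φ ≤ oneMax ((o ∘ s) i))).image s := by
      intro j hj
      simp only [mem_filter, mem_univ, true_and] at hj
      by_cases hex : ∃ i', s i' = j
      · obtain ⟨i', rfl⟩ := hex
        exact Finset.mem_image_of_mem _ (by simpa using hj)
      · push Not at hex
        have := hs.2 j hex i
        omega
    exact (Finset.card_le_card this).trans Finset.card_image_le

/-! ### Mutation -/

lemma sum_prod_pi {ι κ : Type*} [Fintype ι] [Fintype κ] [DecidableEq ι] (f : ι → κ → ℝ) :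
    ∑ o : ι → κ, ∏ i, f i (o i) = ∏ i, ∑ y, f i y := by
  rw [Finset.prod_univ_sum, Fintype.piFinset_univ]

lemma mutProb_nonneg (n : ℕ) (x y : Pt n) : 0 ≤ mutProb n x y := by
  refine Finset.prod_nonneg fun i _ => ?_
  have hn : (1 : ℝ) ≤ n := by exact_mod_cast i.pos
  have : 1 / (n : ℝ) ≤ 1 := by rw [div_le_one (by linarith)]; exact hn
  split_ifs
  · linarith
  · positivity

lemma mutProb_sum (n : ℕ) (x : Pt n) : ∑ y, mutProb n x y = 1 := by
  unfold mutProb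
  rw [sum_prod_pi (fun i b => if b = x i then 1 - 1 / (n : ℝ) else 1 / (n : ℝ))]
  refine Finset.prod_eq_one fun i _ => ?_
  rw [Fintype.sum_bool]
  cases x i <;> simp

def flip' {n : ℕ} (x : Pt n) (i : Fin n) : Pt n := Function.update x i (!x i)

lemma flip_inj {n : ℕ} (x : Pt n) : Function.Injective (flip' x) := by
  intro i j hij
  by_contra hne
  have := congrFun hij i
  simp [flip', Function.update_of_ne hne] at this

lemma flip_ne {n : ℕ} (x : Pt n) (i : Fin n) : flip' x i ≠ x := by
  intro h
  have := congrFun h i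
  simp [flip'] at this

lemma mut_self (n : ℕ) (x : Pt n) : mutProb n x x = (1 - 1 / (n : ℝ)) ^ n := by
  simp [mutProb]

lemma mut_flip (n : ℕ) (x : Pt n) (i : Fin n) :
    mutProb n x (flip' x i) = (1 / (n : ℝ)) * (1 - 1 / (n : ℝ)) ^ (n - 1) := by
  unfold mutProb
  rw [← Finset.mul_prod_erase univ _ (Finset.mem_univ i)]
  congr 1
  · simp [flip']
  · rw [Finset.prod_congr rfl (g := fun _ => 1 - 1 / (n : ℝ))]
    · simp
    · intro j hj
      rw [if_pos]
      simp [flip', Function.update_of_ne (Finset.ne_of_mem_erase hj)]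

lemma flip_at {n : ℕ} (x : Pt n) (i : Fin n) : flip' x i i = !x i := by simp [flip']

lemma flip_of_ne {n : ℕ} (x : Pt n) (i j : Fin n) (h : j ≠ i) : flip' x i j = x j := by
  simp [flip', Function.update_of_ne h]

lemma oneMax_flip_false {n : ℕ} (x : Pt n) (i : Fin n) (h : x i = false) :
    oneMax (flip' x i) = oneMax x + 1 := by
  unfold oneMax
  rw [← Finset.card_insert_of_notMem (a := i) (by simp [h])]
  congr 1
  ext j
  by_cases hj : j = i
  · subst hj; simp [flip_at, h]
  · simp [flip_of_ne x i j hj, hj]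

lemma oneMax_flip_true {n : ℕ} (x : Pt n) (i : Fin n) (h : x i = true) :
    oneMax (flip' x i) + 1 = oneMax x := by
  unfold oneMax
  rw [← Finset.card_insert_of_notMem (a := i) (by simp [flip', h])]
  congr 1
  ext j
  by_cases hj : j = i
  · subst hj; simp [h]
  · simp [flip_of_ne x i j hj, hj]

lemma zeros_card {n : ℕ} (x : Pt n) :
    (univ.filter (fun i => x i = false)).card + oneMax x = n := by
  unfold oneMax
  have := Finset.card_filter_add_card_filter_not (s := (univ : Finset (Fin n)))
    (fun i => x i = false)
  simp only [Bool.not_eq_false, card_univ, Fintype.card_fin] at this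
  convert this

noncomputable def tailP {n : ℕ} (x : Pt n) (φ : ℕ) : ℝ :=
  ∑ y ∈ univ.filter (fun y : Pt n => φ ≤ oneMax y), mutProb n x y

lemma tail_flips {n : ℕ} (x : Pt n) (φ : ℕ) (S : Finset (Fin n))
    (hS : ∀ i ∈ S, φ ≤ oneMax (flip' x i)) :
    (S.card : ℝ) * ((1 / (n : ℝ)) * (1 - 1 / (n : ℝ)) ^ (n - 1)) ≤ tailP x φ := by
  have h1 : ∑ y ∈ S.image (flip' x), mutProb n x y
      = (S.card : ℝ) * ((1 / (n : ℝ)) * (1 - 1 / (n : ℝ)) ^ (n - 1)) := by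
    rw [Finset.sum_image (fun a _ b _ h => flip_inj x h)]
    simp [mut_flip]
  rw [← h1]
  refine Finset.sum_le_sum_of_subset_of_nonneg ?_ (fun y _ _ => mutProb_nonneg n x y)
  intro y hy
  obtain ⟨i, hi, rfl⟩ := Finset.mem_image.1 hy
  simpa using hS i hi

lemma tail_flips_self {n : ℕ} (x : Pt n) (φ : ℕ) (S : Finset (Fin n)) (hx : φ ≤ oneMax x)
    (hS : ∀ i ∈ S, φ ≤ oneMax (flip' x i)) :
    (1 - 1 / (n : ℝ)) ^ n + (S.card : ℝ) * ((1 / (n : ℝ)) * (1 - 1 / (n : ℝ)) ^ (n - 1))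
      ≤ tailP x φ := by
  have h1 : ∑ y ∈ insert x (S.image (flip' x)), mutProb n x y
      = (1 - 1 / (n : ℝ)) ^ n
        + (S.card : ℝ) * ((1 / (n : ℝ)) * (1 - 1 / (n : ℝ)) ^ (n - 1)) := by
    rw [Finset.sum_insert, Finset.sum_image (fun a _ b _ h => flip_inj x h), mut_self]
    · simp [mut_flip]
    · intro h
      obtain ⟨i, -, hi⟩ := Finset.mem_image.1 h
      exact flip_ne x i hi
  rw [← h1]
  refine Finset.sum_le_sum_of_subset_of_nonneg ?_ (fun y _ _ => mutProb_nonneg n x y)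
  intro y hy
  rcases Finset.mem_insert.1 hy with rfl | hy
  · simpa using hx
  · obtain ⟨i, hi, rfl⟩ := Finset.mem_image.1 hy
    simpa using hS i hi

lemma tail_nonneg {n : ℕ} (x : Pt n) (φ : ℕ) : 0 ≤ tailP x φ :=
  Finset.sum_nonneg fun _ _ => mutProb_nonneg _ _ _

/-- Bounds with `ρ = (1-1/n)^(n-1)`. -/
lemma tail_same {n : ℕ} (hn : 0 < n) (x : Pt n) (φ : ℕ) (hx : φ ≤ oneMax x) :
    (1 - 1 / (n : ℝ)) * (1 - 1 / (n : ℝ)) ^ (n - 1) ≤ tailP x φ := by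
  have := tail_flips_self x φ ∅ hx (by simp)
  have h2 : (1 - 1 / (n : ℝ)) ^ n = (1 - 1 / (n : ℝ)) * (1 - 1 / (n : ℝ)) ^ (n - 1) := by
    rw [← pow_succ', Nat.sub_add_cancel hn]
  rw [← h2]
  simpa using this

lemma tail_below {n : ℕ} (hn : 0 < n) (x : Pt n) (φ : ℕ) (hx : φ + 1 ≤ oneMax x) :
    (2 - 1 / (n : ℝ)) * (1 - 1 / (n : ℝ)) ^ (n - 1) ≤ tailP x φ := by
  have := tail_flips_self x φ univ (by omega) (by
    intro i _
    cases h : x i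
    · rw [oneMax_flip_false x i h]; omega
    · have := oneMax_flip_true x i h; omega)
  have h2 : (1 - 1 / (n : ℝ)) ^ n = (1 - 1 / (n : ℝ)) * (1 - 1 / (n : ℝ)) ^ (n - 1) := by
    rw [← pow_succ', Nat.sub_add_cancel hn]
  have hn' : (n : ℝ) ≠ 0 := by positivity
  have h3 : (n : ℝ) * (1 / n) = 1 := by field_simp
  rw [h2, card_univ, Fintype.card_fin, ← mul_assoc, h3] at this
  linarith

lemma tail_above {n : ℕ} (x : Pt n) (φ : ℕ) (hx : oneMax x = φ) :
    (((n : ℝ) - φ) / n) * (1 - 1 / (n : ℝ)) ^ (n - 1) ≤ tailP x (φ + 1) := by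
  have := tail_flips x (φ + 1) (univ.filter (fun i => x i = false)) (by
    intro i hi
    rw [oneMax_flip_false x i (by simpa using hi)]; omega)
  have h1 := zeros_card x
  have h2 : (((univ.filter (fun i => x i = false)).card : ℕ) : ℝ) = (n : ℝ) - φ := by
    rw [eq_sub_iff_add_eq]; subst hx; exact_mod_cast h1
  rw [h2] at this
  convert this using 1
  ring

lemma tail_same' {n : ℕ} (hn : 0 < n) (x : Pt n) (φ : ℕ) (hx : oneMax x = φ) :
    (1 - 1 / (n : ℝ) + ((n : ℝ) - φ) / n) * (1 - 1 / (n : ℝ)) ^ (n - 1) ≤ tailP x φ := by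
  have := tail_flips_self x φ (univ.filter (fun i => x i = false)) hx.ge (by
    intro i hi
    rw [oneMax_flip_false x i (by simpa using hi)]; omega)
  have h1 := zeros_card x
  have h2 : (((univ.filter (fun i => x i = false)).card : ℕ) : ℝ) = (n : ℝ) - φ := by
    rw [eq_sub_iff_add_eq]; subst hx; exact_mod_cast h1
  have h3 : (1 - 1 / (n : ℝ)) ^ n = (1 - 1 / (n : ℝ)) * (1 - 1 / (n : ℝ)) ^ (n - 1) := by
    rw [← pow_succ', Nat.sub_add_cancel hn]
  rw [h2, h3] at this
  convert this using 1
  ring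
/-! ### Expectation over the offspring -/

noncomputable def EV (n μ lam : ℕ) (P : Fin μ → Pt n) (F : (Fin lam → Pt n) → ℝ) : ℝ :=
  ∑ o, offVecProb n μ lam P o * F o

lemma offProb_nonneg (n μ : ℕ) (P : Fin μ → Pt n) (y : Pt n) : 0 ≤ offProb n μ P y :=
  div_nonneg (Finset.sum_nonneg fun _ _ => mutProb_nonneg _ _ _) (Nat.cast_nonneg _)

lemma offVec_nonneg (n μ lam : ℕ) (P : Fin μ → Pt n) (o : Fin lam → Pt n) :
    0 ≤ offVecProb n μ lam P o :=
  Finset.prod_nonneg fun _ _ => offProb_nonneg _ _ _ _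

lemma offProb_sum (n μ : ℕ) (hμ : 0 < μ) (P : Fin μ → Pt n) : ∑ y, offProb n μ P y = 1 := by
  unfold offProb
  rw [← Finset.sum_div, Finset.sum_comm]
  simp_rw [mutProb_sum]
  simp only [sum_const, card_univ, Fintype.card_fin, nsmul_eq_mul, mul_one]
  exact div_self (by positivity)

lemma stepProb_nonneg (n μ lam : ℕ) (P Q : Fin μ → Pt n) : 0 ≤ stepProb n μ lam P Q :=
  Finset.sum_nonneg fun _ _ => mul_nonneg (offVec_nonneg _ _ _ _ _) (by positivity)

lemma step_le_EV (n μ lam : ℕ) (P : Fin μ → Pt n) (F : (Fin μ → Pt n) → ℝ)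
    (G : (Fin lam → Pt n) → ℝ) (hG : ∀ o, 0 ≤ G o)
    (hFG : ∀ o (s : Fin μ → Fin lam), validSel o s → F (o ∘ s) ≤ G o) :
    ∑ Q, stepProb n μ lam P Q * F Q ≤ EV n μ lam P G := by
  unfold stepProb EV
  simp_rw [Finset.sum_mul]
  rw [Finset.sum_comm]
  refine Finset.sum_le_sum fun o _ => ?_
  simp_rw [mul_assoc]
  rw [← Finset.mul_sum]
  refine mul_le_mul_of_nonneg_left ?_ (offVec_nonneg _ _ _ _ _)
  set N : ℝ := ((univ.filter (fun s : Fin μ → Fin lam => validSel o s)).card : ℝ) with hN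
  have h1 : ∑ Q : Fin μ → Pt n,
      ((univ.filter (fun s : Fin μ → Fin lam => validSel o s ∧ o ∘ s = Q)).card : ℝ) * F Q
      = ∑ s ∈ univ.filter (fun s : Fin μ → Fin lam => validSel o s), F (o ∘ s) := by
    rw [← Finset.sum_fiberwise_of_maps_to (s := univ.filter (fun s : Fin μ → Fin lam => validSel o s))
      (t := (univ : Finset (Fin μ → Pt n))) (g := fun s => o ∘ s) (fun _ _ => Finset.mem_univ _)]
    refine Finset.sum_congr rfl fun Q _ => ?_
    rw [Finset.filter_filter, Finset.sum_congr rfl (g := fun _ => F Q)]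
    · simp
    · intro s hs
      rw [(Finset.mem_filter.1 hs).2.2]
  have h2 : ∑ s ∈ univ.filter (fun s : Fin μ → Fin lam => validSel o s), F (o ∘ s) ≤ N * G o := by
    rw [hN, ← nsmul_eq_mul]
    refine Finset.sum_le_card_nsmul _ _ _ fun s hs => hFG o s (Finset.mem_filter.1 hs).2
  have h3 : ∑ Q : Fin μ → Pt n,
      ((univ.filter (fun s : Fin μ → Fin lam => validSel o s ∧ o ∘ s = Q)).card : ℝ) / N * F Q
      = (∑ s ∈ univ.filter (fun s : Fin μ → Fin lam => validSel o s), F (o ∘ s)) / N := by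
    rw [← h1, Finset.sum_div]
    exact Finset.sum_congr rfl fun Q _ => by ring
  rw [h3]
  have hN0 : 0 ≤ N := Nat.cast_nonneg _
  rcases hN0.eq_or_lt with h0 | hpos
  · rw [← h0]; simpa using hG o
  · rw [div_le_iff₀ hpos]; linarith

lemma EV_mono (n μ lam : ℕ) (P : Fin μ → Pt n) (F G : (Fin lam → Pt n) → ℝ)
    (h : ∀ o, F o ≤ G o) : EV n μ lam P F ≤ EV n μ lam P G :=
  Finset.sum_le_sum fun o _ => mul_le_mul_of_nonneg_left (h o) (offVec_nonneg _ _ _ _ _)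

lemma EV_add (n μ lam : ℕ) (P : Fin μ → Pt n) (F G : (Fin lam → Pt n) → ℝ) :
    EV n μ lam P (fun o => F o + G o) = EV n μ lam P F + EV n μ lam P G := by
  unfold EV
  rw [← Finset.sum_add_distrib]
  exact Finset.sum_congr rfl fun o _ => by ring

lemma EV_mul (n μ lam : ℕ) (P : Fin μ → Pt n) (c : ℝ) (F : (Fin lam → Pt n) → ℝ) :
    EV n μ lam P (fun o => c * F o) = c * EV n μ lam P F := by
  unfold EV
  rw [Finset.mul_sum]
  exact Finset.sum_congr rfl fun o _ => by ring

lemma EV_const (n μ lam : ℕ) (hμ : 0 < μ) (P : Fin μ → Pt n) (c : ℝ) :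
    EV n μ lam P (fun _ => c) = c := by
  unfold EV offVecProb
  rw [← Finset.sum_mul, sum_prod_pi (fun (_ : Fin lam) y => offProb n μ P y)]
  simp [offProb_sum n μ hμ P]

noncomputable def pT (n μ : ℕ) (P : Fin μ → Pt n) (φ : ℕ) : ℝ :=
  ∑ y, offProb n μ P y * (if φ ≤ oneMax y then 1 else 0)

lemma pT_nonneg (n μ : ℕ) (P : Fin μ → Pt n) (φ : ℕ) : 0 ≤ pT n μ P φ :=
  Finset.sum_nonneg fun _ _ => mul_nonneg (offProb_nonneg _ _ _ _) (by split_ifs <;> norm_num)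

lemma pT_eq (n μ : ℕ) (P : Fin μ → Pt n) (φ : ℕ) :
    pT n μ P φ = (∑ i, tailP (P i) φ) / μ := by
  unfold pT offProb tailP
  simp_rw [div_mul_eq_mul_div]
  rw [← Finset.sum_div]
  congr 1
  simp_rw [Finset.sum_mul]
  rw [Finset.sum_comm]
  refine Finset.sum_congr rfl fun i _ => ?_
  rw [Finset.sum_filter]
  refine Finset.sum_congr rfl fun y _ => ?_
  split_ifs <;> simp

lemma cge_cast {n m : ℕ} (o : Fin m → Pt n) (φ : ℕ) :
    (cge o φ : ℝ) = ∑ j, (if φ ≤ oneMax (o j) then (1 : ℝ) else 0) := by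
  unfold cge
  rw [Finset.card_filter]
  push_cast
  rfl

lemma EV_cge (n μ lam : ℕ) (hμ : 0 < μ) (P : Fin μ → Pt n) (φ : ℕ) :
    EV n μ lam P (fun o => (cge o φ : ℝ)) = lam * pT n μ P φ := by
  unfold EV offVecProb
  simp_rw [cge_cast, Finset.mul_sum]
  rw [Finset.sum_comm]
  have key : ∀ i : Fin lam, ∑ o : Fin lam → Pt n, (∏ j, offProb n μ P (o j)) *
      (if φ ≤ oneMax (o i) then (1 : ℝ) else 0) = pT n μ P φ := by
    intro i
    have h1 : ∀ o : Fin lam → Pt n, (∏ j, offProb n μ P (o j)) *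
        (if φ ≤ oneMax (o i) then (1 : ℝ) else 0)
        = ∏ j, (fun (j : Fin lam) (y : Pt n) => offProb n μ P y *
          (if j = i then (if φ ≤ oneMax y then (1 : ℝ) else 0) else 1)) j (o j) := by
      intro o
      simp only
      rw [Finset.prod_mul_distrib]
      congr 1
      rw [Finset.prod_eq_single i]
      · simp
      · intro j _ hj
        rw [if_neg hj]
      · simp
    rw [Finset.sum_congr rfl (fun o _ => h1 o)]
    rw [sum_prod_pi (fun (j : Fin lam) (y : Pt n) => offProb n μ P y *
          (if j = i then (if φ ≤ oneMax y then (1 : ℝ) else 0) else 1)), Finset.prod_eq_single i]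
    · simp [pT]
    · intro j _ hj
      simp [hj, offProb_sum n μ hμ P]
    · simp
  rw [Finset.sum_congr rfl (fun i _ => key i)]
  simp

lemma EV_exp_le (n μ lam : ℕ) (hμ : 0 < μ) (P : Fin μ → Pt n) (φ : ℕ) (a b : ℝ) :
    EV n μ lam P (fun o => Real.exp (a * cge o φ + b * cge o (φ + 1))) ≤
      Real.exp (lam * pT n μ P φ * (Real.exp a - 1)
        + lam * pT n μ P (φ + 1) * (Real.exp (a + b) - Real.exp a)) := by
  let c : Pt n → ℝ := fun y => a * (if φ ≤ oneMax y then (1 : ℝ) else 0)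
    + b * (if φ + 1 ≤ oneMax y then (1 : ℝ) else 0)
  have h1 : EV n μ lam P (fun o => Real.exp (a * cge o φ + b * cge o (φ + 1)))
      = (∑ y, offProb n μ P y * Real.exp (c y)) ^ lam := by
    unfold EV offVecProb
    have : ∀ o : Fin lam → Pt n, (∏ j, offProb n μ P (o j)) *
        Real.exp (a * cge o φ + b * cge o (φ + 1))
        = ∏ j, (fun (_ : Fin lam) (y : Pt n) => offProb n μ P y * Real.exp (c y)) j (o j) := by
      intro o
      simp only
      rw [Finset.prod_mul_distrib, ← Real.exp_sum]
      congr 2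
      simp only [c]
      rw [Finset.sum_add_distrib, ← Finset.mul_sum, ← Finset.mul_sum, cge_cast, cge_cast]
    rw [Finset.sum_congr rfl (fun o _ => this o)]
    rw [sum_prod_pi (fun (_ : Fin lam) (y : Pt n) => offProb n μ P y * Real.exp (c y))]
    simp
  have h2 : ∑ y, offProb n μ P y * Real.exp (c y)
      = 1 + (pT n μ P φ * (Real.exp a - 1)
        + pT n μ P (φ + 1) * (Real.exp (a + b) - Real.exp a)) := by
    have hone := offProb_sum n μ hμ P
    unfold pT
    rw [← sub_eq_iff_eq_add', ← hone, ← Finset.sum_sub_distrib, Finset.sum_mul, Finset.sum_mul,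
      ← Finset.sum_add_distrib]
    refine Finset.sum_congr rfl fun y _ => ?_
    simp only [c]
    by_cases h1 : φ ≤ oneMax y
    · by_cases h2 : φ + 1 ≤ oneMax y
      · simp only [h1, h2, if_true, mul_one, hone]; ring
      · simp only [h1, h2, if_true, if_false, mul_one, mul_zero, add_zero, hone]; ring
    · have h2 : ¬ φ + 1 ≤ oneMax y := by omega
      simp [h1, h2]
  have h3 : 0 ≤ ∑ y, offProb n μ P y * Real.exp (c y) :=
    Finset.sum_nonneg fun y _ => mul_nonneg (offProb_nonneg _ _ _ _) (Real.exp_pos _).le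
  rw [h1]
  set u := pT n μ P φ * (Real.exp a - 1)
        + pT n μ P (φ + 1) * (Real.exp (a + b) - Real.exp a) with hu
  have h4 : ∑ y, offProb n μ P y * Real.exp (c y) ≤ Real.exp u := by
    rw [h2]; linarith [Real.add_one_le_exp u]
  calc (∑ y, offProb n μ P y * Real.exp (c y)) ^ lam ≤ (Real.exp u) ^ lam := by gcongr
    _ = Real.exp (lam * u) := by rw [← Real.exp_nat_mul]
    _ = _ := by congr 1; rw [hu]; ring

lemma EV_exp_one_le (n μ lam : ℕ) (hμ : 0 < μ) (P : Fin μ → Pt n) (φ : ℕ) (a : ℝ) :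
    EV n μ lam P (fun o => Real.exp (a * cge o φ)) ≤
      Real.exp (lam * pT n μ P φ * (Real.exp a - 1)) := by
  have := EV_exp_le n μ lam hμ P φ a 0
  simpa using this

/-- truncated mean -/
lemma EV_min_ge (n μ lam : ℕ) (hμ : 0 < μ) (P : Fin μ → Pt n) (φ : ℕ) (t M θ : ℝ)
    (ht : 0 < t) (htv : t ≤ lam * pT n μ P φ) (hθ : 0 < θ) (hθ1 : θ ≤ 1) :
    t - (1 / θ) * Real.exp (θ ^ 2 * t + θ * (t - M)) ≤
      EV n μ lam P (fun o => min (cge o φ : ℝ) M) := by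
  set v := lam * pT n μ P φ with hv
  have hvpos : 0 < v := lt_of_lt_of_le ht htv
  set r := t / v with hr
  have hr0 : 0 < r := div_pos ht hvpos
  have hr1 : r ≤ 1 := (div_le_one hvpos).2 htv
  have hrv : r * v = t := by rw [hr]; field_simp
  have h1 : ∀ o : Fin lam → Pt n, r * (cge o φ : ℝ)
      + (-(1 / θ * Real.exp (-(θ * M)))) * Real.exp ((θ * r) * cge o φ)
      ≤ min (cge o φ : ℝ) M := by
    intro o
    have hc : (0 : ℝ) ≤ cge o φ := Nat.cast_nonneg _
    have he : (-(1 / θ * Real.exp (-(θ * M)))) * Real.exp ((θ * r) * cge o φ)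
        = -(1 / θ * Real.exp (θ * (r * cge o φ - M))) := by
      rw [neg_mul, mul_assoc, ← Real.exp_add]
      congr 3
      ring
    rw [he]
    have hpos : 0 < 1 / θ * Real.exp (θ * (r * cge o φ - M)) := by positivity
    have hge : r * cge o φ - M ≤ 1 / θ * Real.exp (θ * (r * cge o φ - M)) := by
      have := Real.add_one_le_exp (θ * (r * cge o φ - M))
      rw [one_div, ← div_eq_inv_mul, le_div_iff₀ hθ]
      linarith
    apply le_min
    · nlinarith
    · linarith
  have h2 := EV_mono n μ lam P _ _ h1
  rw [EV_add, EV_mul, EV_mul, EV_cge n μ lam hμ] at h2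
  have h3 := EV_exp_one_le n μ lam hμ P φ (θ * r)
  rw [← hv] at h2 h3
  have h4 : v * (Real.exp (θ * r) - 1) ≤ θ * t + θ ^ 2 * t := by
    have hx0 : 0 ≤ θ * r := by positivity
    have hx1 : θ * r ≤ 1 := by nlinarith
    have := Real.abs_exp_sub_one_sub_id_le (x := θ * r) (by rw [abs_of_nonneg hx0]; exact hx1)
    have h5 := (abs_le.1 this).2
    have h6 : Real.exp (θ * r) - 1 ≤ θ * r + (θ * r) ^ 2 := by linarith
    have h7 : v * (Real.exp (θ * r) - 1) ≤ v * (θ * r + (θ * r) ^ 2) :=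
      mul_le_mul_of_nonneg_left h6 hvpos.le
    have h8 : v * (θ * r + (θ * r) ^ 2) = θ * t + θ ^ 2 * t * r := by rw [← hrv]; ring
    have h9 : θ ^ 2 * t * r ≤ θ ^ 2 * t := mul_le_of_le_one_right (by positivity) hr1
    linarith
  have h5 : (1 / θ * Real.exp (-(θ * M))) * EV n μ lam P (fun o => Real.exp ((θ * r) * cge o φ))
      ≤ (1 / θ * Real.exp (-(θ * M))) * Real.exp (θ * t + θ ^ 2 * t) :=
    mul_le_mul_of_nonneg_left (h3.trans (Real.exp_le_exp.2 h4)) (by positivity)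
  have h6 : (1 / θ * Real.exp (-(θ * M))) * Real.exp (θ * t + θ ^ 2 * t)
      = (1 / θ) * Real.exp (θ ^ 2 * t + θ * (t - M)) := by
    rw [mul_assoc, ← Real.exp_add]
    congr 2
    ring
  rw [hrv] at h2
  linarith

/-- lower tail -/
lemma EV_tail_le (n μ lam : ℕ) (hμ : 0 < μ) (P : Fin μ → Pt n) (φ : ℕ) (t a θ : ℝ)
    (ht : 0 < t) (htv : t ≤ lam * pT n μ P φ) (hθ : 0 < θ) (hθ1 : θ ≤ 1) :
    EV n μ lam P (fun o => Real.exp (θ * a) * Real.exp ((-θ) * cge o φ)) ≤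
      Real.exp (-(θ * (t - a)) + θ ^ 2 * t) := by
  rw [EV_mul]
  have h3 := EV_exp_one_le n μ lam hμ P φ (-θ)
  have h4 : lam * pT n μ P φ * (Real.exp (-θ) - 1) ≤ -(θ * t) + θ ^ 2 * t := by
    have := Real.abs_exp_sub_one_sub_id_le (x := -θ) (by rw [abs_neg, abs_of_pos hθ]; exact hθ1)
    have h5 := (abs_le.1 this).2
    have h6 : Real.exp (-θ) - 1 ≤ 0 := by
      have : Real.exp (-θ) ≤ 1 := Real.exp_le_one_iff.2 (by linarith)
      linarith
    nlinarith
  calc Real.exp (θ * a) * EV n μ lam P (fun o => Real.exp ((-θ) * cge o φ))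
      ≤ Real.exp (θ * a) * Real.exp (-(θ * t) + θ ^ 2 * t) :=
        mul_le_mul_of_nonneg_left (h3.trans (Real.exp_le_exp.2 h4)) (Real.exp_pos _).le
    _ = _ := by rw [← Real.exp_add]; congr 1; ring
/-! ### Rates -/

lemma rho_ge (n : ℕ) (hn : 2 ≤ n) :
    Real.exp (-1) * (1 + 1 / (2 * (n : ℝ))) ≤ (1 - 1 / (n : ℝ)) ^ (n - 1) := by
  obtain ⟨m, rfl⟩ : ∃ m, n = m + 1 := ⟨n - 1, by omega⟩
  have hm : (1 : ℝ) ≤ m := by exact_mod_cast (by omega : 1 ≤ m)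
  have hm0 : (0 : ℝ) < m := by linarith
  have ht : (0 : ℝ) < ((m : ℝ) + 1) / m := by positivity
  have h1 : Real.log (((m : ℝ) + 1) / m) ≤ ((((m : ℝ) + 1) / m) - (((m : ℝ) + 1) / m)⁻¹) / 2 := by
    rw [← Real.sinh_log ht]
    apply Real.self_le_sinh_iff.2
    apply Real.log_nonneg
    rw [le_div_iff₀ hm0]; linarith
  have h2 : (m : ℝ) * (((((m : ℝ) + 1) / m) - (((m : ℝ) + 1) / m)⁻¹) / 2)
      = 1 - 1 / (2 * ((m : ℝ) + 1)) := by
    field_simp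
    ring
  have h3 : (m : ℝ) * Real.log (((m : ℝ) + 1) / m) ≤ 1 - 1 / (2 * ((m : ℝ) + 1)) := by
    rw [← h2]; exact mul_le_mul_of_nonneg_left h1 hm0.le
  have h4 : (1 - 1 / (((m + 1 : ℕ)) : ℝ)) ^ (m + 1 - 1)
      = Real.exp (-(m * Real.log (((m : ℝ) + 1) / m))) := by
    have : (1 - 1 / (((m + 1 : ℕ)) : ℝ)) = Real.exp (-Real.log (((m : ℝ) + 1) / m)) := by
      rw [Real.exp_neg, Real.exp_log ht]
      push_cast
      field_simp
      ring
    rw [this, Nat.add_sub_cancel, ← Real.exp_nat_mul]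
    congr 1
    ring
  rw [h4]
  push_cast
  calc Real.exp (-1) * (1 + 1 / (2 * ((m : ℝ) + 1)))
      ≤ Real.exp (-1) * Real.exp (1 / (2 * ((m : ℝ) + 1))) := by
        gcongr
        linarith [Real.add_one_le_exp (1 / (2 * ((m : ℝ) + 1)))]
    _ = Real.exp (-1 + 1 / (2 * ((m : ℝ) + 1))) := by rw [Real.exp_add]
    _ ≤ _ := by
        apply Real.exp_le_exp.2
        linarith

lemma rate_aux (n μ lam : ℕ) (hn : 2 ≤ n) (hμ : 0 < μ)
    (hlam : Real.exp 1 * (μ : ℝ) ≤ (lam : ℝ)) (P : Fin μ → Pt n) (φ : ℕ) (K : ℝ) (hK : 0 ≤ K)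
    (h : K * (1 - 1 / (n : ℝ)) ^ (n - 1) ≤ ∑ i, tailP (P i) φ) :
    (1 + 1 / (2 * (n : ℝ))) * K ≤ lam * pT n μ P φ := by
  have hr := rho_ge n hn
  have hμ' : (0 : ℝ) < μ := by exact_mod_cast hμ
  rw [pT_eq]
  have h1 : K * (Real.exp (-1) * (1 + 1 / (2 * (n : ℝ)))) ≤ ∑ i, tailP (P i) φ :=
    (mul_le_mul_of_nonneg_left hr hK).trans h
  have h0 : 0 ≤ ∑ i, tailP (P i) φ := Finset.sum_nonneg fun i _ => tail_nonneg _ _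
  have h2 : Real.exp 1 * (μ : ℝ) * ((∑ i, tailP (P i) φ) / μ) ≤
      lam * ((∑ i, tailP (P i) φ) / μ) :=
    mul_le_mul_of_nonneg_right hlam (div_nonneg h0 hμ'.le)
  have h3 : Real.exp 1 * (μ : ℝ) * ((∑ i, tailP (P i) φ) / μ)
      = Real.exp 1 * (∑ i, tailP (P i) φ) := by field_simp
  have h4 : Real.exp 1 * (K * (Real.exp (-1) * (1 + 1 / (2 * (n : ℝ)))))
      = (1 + 1 / (2 * (n : ℝ))) * K := by
    have : Real.exp 1 * Real.exp (-1) = 1 := by rw [← Real.exp_add]; simp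
    linear_combination (K * (1 + 1 / (2 * (n : ℝ)))) * this
  have h5 := mul_le_mul_of_nonneg_left h1 (Real.exp_pos 1).le
  linarith

lemma rate_Y (n μ lam f : ℕ) (hn : 2 ≤ n) (hf : f < n) (hμ : 0 < μ)
    (hlam : Real.exp 1 * (μ : ℝ) ≤ (lam : ℝ)) (P : Fin μ → Pt n) :
    (1 + 1 / (2 * (n : ℝ))) * ((cge P (f + 1) : ℝ) * (1 - 1 / n)
        + ((cge P f : ℝ) - cge P (f + 1)) * (((n : ℝ) - f) / n))
      ≤ lam * pT n μ P (f + 1) := by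
  have hYZ : (cge P (f + 1) : ℝ) ≤ cge P f := by exact_mod_cast cge_anti P f
  have hY0 : (0 : ℝ) ≤ cge P (f + 1) := Nat.cast_nonneg _
  have hn' : (2 : ℝ) ≤ n := by exact_mod_cast hn
  have hf' : (f : ℝ) ≤ n := by exact_mod_cast hf.le
  have hd : 0 ≤ ((n : ℝ) - f) / n := div_nonneg (by linarith) (by linarith)
  have h1n : 0 ≤ 1 - 1 / (n : ℝ) := by
    rw [sub_nonneg, div_le_one (by linarith)]; linarith
  apply rate_aux n μ lam hn hμ hlam
  · have := mul_nonneg hY0 h1n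
    have := mul_nonneg (sub_nonneg.2 hYZ) hd
    linarith
  · rw [cge_cast, cge_cast, ← Finset.sum_sub_distrib, Finset.sum_mul, Finset.sum_mul,
      ← Finset.sum_add_distrib, Finset.sum_mul]
    refine Finset.sum_le_sum fun i _ => ?_
    by_cases h1 : f + 1 ≤ oneMax (P i)
    · have := tail_same (by omega) (P i) (f + 1) h1
      have h2 : f ≤ oneMax (P i) := by omega
      simp only [h1, h2, if_true, sub_self, zero_mul, add_zero, one_mul]
      exact this
    · by_cases h2 : f ≤ oneMax (P i)
      · have := tail_above (P i) f (by omega)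
        simp only [h1, h2, if_true, if_false, sub_zero, zero_mul, zero_add, one_mul]
        exact this
      · simp only [h1, h2, if_false, sub_zero, zero_mul, zero_add]
        exact tail_nonneg _ _

lemma rate_Z (n μ lam f : ℕ) (hn : 2 ≤ n) (hf : f < n) (hμ : 0 < μ)
    (hlam : Real.exp 1 * (μ : ℝ) ≤ (lam : ℝ)) (P : Fin μ → Pt n) :
    (cge P f : ℝ) + (cge P (f + 1) : ℝ) * (1 - 1 / n) ≤ lam * pT n μ P f := by
  have hY0 : (0 : ℝ) ≤ cge P (f + 1) := Nat.cast_nonneg _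
  have hZ0 : (0 : ℝ) ≤ cge P f := Nat.cast_nonneg _
  have hn' : (2 : ℝ) ≤ n := by exact_mod_cast hn
  have hf' : (f : ℝ) + 1 ≤ n := by exact_mod_cast hf
  have h1n : 0 ≤ 1 - 1 / (n : ℝ) := by
    rw [sub_nonneg, div_le_one (by linarith)]; linarith
  have hρ : 0 ≤ (1 - 1 / (n : ℝ)) ^ (n - 1) := pow_nonneg h1n _
  have hd : 1 / (n : ℝ) ≤ ((n : ℝ) - f) / n := by
    apply div_le_div_of_nonneg_right <;> linarith
  have hK : 0 ≤ (cge P f : ℝ) + (cge P (f + 1) : ℝ) * (1 - 1 / n) :=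
    add_nonneg hZ0 (mul_nonneg hY0 h1n)
  have := rate_aux n μ lam hn hμ hlam P f _ hK (by
    rw [cge_cast, cge_cast, Finset.sum_mul, ← Finset.sum_add_distrib, Finset.sum_mul]
    refine Finset.sum_le_sum fun i _ => ?_
    by_cases h1 : f + 1 ≤ oneMax (P i)
    · have := tail_below (by omega) (P i) f h1
      have h2 : f ≤ oneMax (P i) := by omega
      simp only [h1, h2, if_true, one_mul]
      refine le_trans (le_of_eq ?_) this
      ring
    · by_cases h2 : f ≤ oneMax (P i)
      · have := tail_same' (by omega) (P i) f (by omega)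
        simp only [h1, h2, if_true, if_false, zero_mul, add_zero]
        refine le_trans ?_ this
        apply mul_le_mul_of_nonneg_right _ hρ
        linarith
      · simp only [h1, h2, if_false, zero_mul, zero_add]
        exact tail_nonneg _ _)
  have h2 : 0 ≤ 1 / (2 * (n : ℝ)) := by positivity
  nlinarith [mul_nonneg h2 hK]

/-! ### Drift for the time bound -/

noncomputable def capY (μ : ℕ) (δ : ℝ) : ℝ := μ * (51 / 100 + δ / 4)

noncomputable def Hpot {n μ : ℕ} (f : ℕ) (δ : ℝ) (P : Fin μ → Pt n) : ℝ :=
  capY μ δ + 2 * δ * μ - (min (cge P (f + 1) : ℝ) (capY μ δ) + 2 * δ * cge P f)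

lemma Hpot_nonneg {n μ : ℕ} (f : ℕ) (δ : ℝ) (hδ : 0 ≤ δ) (P : Fin μ → Pt n) :
    0 ≤ Hpot f δ P := by
  unfold Hpot
  have h1 := min_le_right (cge P (f + 1) : ℝ) (capY μ δ)
  have h2 : (cge P f : ℝ) ≤ μ := by exact_mod_cast cge_le P f
  nlinarith

set_option maxHeartbeats 400000 in
lemma H_drift (n μ lam f : ℕ) (hn : 100 ≤ n) (hf : f < n) (hμ : 0 < μ)
    (hlam : Real.exp 1 * (μ : ℝ) ≤ (lam : ℝ)) (P : Fin μ → Pt n) (δ : ℝ)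
    (hδ : δ = ((n : ℝ) - f) / n)
    (herrY : 200 * Real.exp (-((1 / 40000) * (μ : ℝ))) ≤ (1 / 500) / n)
    (herrZ : 3000 ≤ Real.sqrt μ)
    (hZ : (μ : ℝ) / 4 ≤ cge P f) (hY : (cge P (f + 1) : ℝ) < (μ : ℝ) / 2) :
    ∑ Q, stepProb n μ lam P Q * Hpot f δ Q ≤ Hpot f δ P - (23 / 100) * δ * μ := by
  have hn' : (100 : ℝ) ≤ n := by exact_mod_cast hn
  have hn0 : (0 : ℝ) < n := by linarith
  have hf' : (f : ℝ) + 1 ≤ n := by exact_mod_cast hf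
  have hf0 : (0 : ℝ) ≤ f := Nat.cast_nonneg _
  have hμ1 : (1 : ℝ) ≤ μ := by exact_mod_cast hμ
  have hδ1 : 1 / (n : ℝ) ≤ δ := by
    rw [hδ]; apply div_le_div_of_nonneg_right <;> linarith
  have hδle : δ ≤ 1 := by rw [hδ, div_le_one hn0]; linarith
  have hin : 0 < 1 / (n : ℝ) := by positivity
  have hin2 : 1 / (n : ℝ) ≤ 1 / 100 := one_div_le_one_div_of_le (by norm_num) hn'
  have hδ0 : 0 < δ := by linarith
  have hrY := rate_Y n μ lam f (by omega) hf hμ hlam P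
  have hrZ := rate_Z n μ lam f (by omega) hf hμ hlam P
  rw [← hδ] at hrY
  have hYZ : (cge P (f + 1) : ℝ) ≤ cge P f := by exact_mod_cast cge_anti P f
  have hZμ : (cge P f : ℝ) ≤ μ := by exact_mod_cast cge_le P f
  have hY0 : (0 : ℝ) ≤ cge P (f + 1) := Nat.cast_nonneg _
  set Y : ℝ := (cge P (f + 1) : ℝ) with hYdef
  set Z : ℝ := (cge P f : ℝ) with hZdef
  set M := capY μ δ with hM
  have hMeq : M = μ * (51 / 100 + δ / 4) := rfl
  have hstep : ∑ Q, stepProb n μ lam P Q * Hpot f δ Q ≤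
      EV n μ lam P (fun o => (M + 2 * δ * μ) + ((-1) * min (cge o (f + 1) : ℝ) M
        + (-(2 * δ)) * min (cge o f : ℝ) μ)) := by
    apply step_le_EV
    · intro o
      have h1 := min_le_right (cge o (f + 1) : ℝ) M
      have h2 := mul_le_mul_of_nonneg_left (min_le_right (cge o f : ℝ) μ)
        (by linarith : (0 : ℝ) ≤ 2 * δ)
      linarith
    · intro o s hs
      have h1 : min (cge o (f + 1) : ℝ) μ ≤ cge (o ∘ s) (f + 1) := by
        exact_mod_cast sel_ge o s hs (f + 1)
      have h2 : min (cge o f : ℝ) μ ≤ cge (o ∘ s) f := by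
        exact_mod_cast sel_ge o s hs f
      have hMμ : M ≤ μ := by
        rw [hMeq]; exact mul_le_of_le_one_right (by linarith) (by linarith)
      have h3 : min (cge o (f + 1) : ℝ) M ≤ min (cge (o ∘ s) (f + 1) : ℝ) M := by
        refine le_min (le_trans ?_ h1) (min_le_right _ _)
        exact min_le_min le_rfl hMμ
      unfold Hpot
      rw [← hM]
      have h4 := mul_le_mul_of_nonneg_left h2 (by linarith : (0 : ℝ) ≤ 2 * δ)
      linarith
  rw [EV_add, EV_const n μ lam hμ, EV_add, EV_mul, EV_mul] at hstep
  -- Y part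
  have hq : 1 / (2 * (n : ℝ)) = (1 / n) / 2 := by field_simp
  rw [hq] at hrY
  set i : ℝ := 1 / (n : ℝ) with hi
  set tY : ℝ := Y + δ * min (Z - (301 / 200) * Y) (μ / 4) with htY
  have hm1 := min_le_left (Z - (301 / 200) * Y) ((μ : ℝ) / 4)
  have hm2 := min_le_right (Z - (301 / 200) * Y) ((μ : ℝ) / 4)
  set m := min (Z - (301 / 200) * Y) ((μ : ℝ) / 4) with hmdef
  have htYpos : 0 < tY := by
    rw [htY]
    rcases min_choice (Z - (301 / 200) * Y) ((μ : ℝ) / 4) with hc | hc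
    · rw [← hmdef] at hc; rw [hc]
      have : -(1 / 2 + 1 / 100) * Y + (Z - Y) ≤ Z - (301 / 200) * Y := by linarith
      by_cases hs : 0 ≤ Z - (301 / 200) * Y
      · by_cases hyz : Y = 0
        · rw [hyz]; rw [hyz] at hs
          have : 0 < δ * (Z - 301 / 200 * 0) := mul_pos hδ0 (by linarith)
          linarith
        · have : 0 < Y := lt_of_le_of_ne hY0 (Ne.symm hyz)
          have := mul_nonneg hδ0.le hs
          linarith
      · push Not at hs
        have hYp : 0 < Y := by linarith
        have e1 : 1 * (Z - (301 / 200) * Y) ≤ δ * (Z - (301 / 200) * Y) :=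
          mul_le_mul_of_nonpos_right hδle hs.le
        linarith
    · rw [← hmdef] at hc; rw [hc]
      have : 0 < δ * ((μ : ℝ) / 4) := by positivity
      linarith
  have htYv : tY ≤ lam * pT n μ P (f + 1) := by
    refine le_trans ?_ hrY
    rw [htY]
    have a1 : δ * m ≤ δ * (Z - (301 / 200) * Y) := mul_le_mul_of_nonneg_left hm1 hδ0.le
    have a2 : 0 ≤ (i / 2) * ((Z - Y) * δ) := by
      have := sub_nonneg.2 hYZ
      positivity
    have a3 : i * Y * (1 / 2 + i / 2) ≤ δ * Y * (101 / 200) := by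
      have : i * Y ≤ δ * Y := mul_le_mul_of_nonneg_right hδ1 hY0
      have h0 : 0 ≤ i * Y := by positivity
      exact mul_le_mul this (by linarith) (by linarith) (by linarith)
    linarith
  have hEY := EV_min_ge n μ lam hμ P (f + 1) tY M (1 / 200) htYpos htYv (by norm_num) (by norm_num)
  have htYle : tY ≤ μ * (1 / 2 + δ / 4) := by
    rw [htY]
    have : δ * m ≤ δ * (μ / 4) := mul_le_mul_of_nonneg_left hm2 hδ0.le
    linarith
  have hexpY : 1 / (1 / 200) * Real.exp ((1 / 200) ^ 2 * tY + 1 / 200 * (tY - M))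
      ≤ 200 * Real.exp (-((1 / 40000) * (μ : ℝ))) := by
    rw [show (1 : ℝ) / (1 / 200) = 200 by norm_num]
    gcongr
    rw [hMeq]
    have hδμ : δ * μ ≤ 1 * μ := mul_le_mul_of_nonneg_right hδle (by linarith)
    linarith
  -- Z part
  set tZ : ℝ := min (Z + Y * (1 - i)) μ with htZ
  have htZv : tZ ≤ lam * pT n μ P f := (min_le_left _ _).trans hrZ
  have htZZ : Z ≤ tZ := le_min (by
    have := mul_nonneg hY0 (by linarith : (0 : ℝ) ≤ 1 - i)
    linarith) hZμ
  have htZpos : 0 < tZ := by linarith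
  have htZμ : tZ ≤ μ := min_le_right _ _
  have hsq : Real.sqrt μ * Real.sqrt μ = μ := Real.mul_self_sqrt (by linarith)
  set r := Real.sqrt μ with hr
  have hr0 : 0 < r := by linarith
  have hEZ := EV_min_ge n μ lam hμ P f tZ μ (1 / r) htZpos htZv (by positivity)
    (by rw [div_le_one hr0]; linarith)
  have hexpZ : 1 / (1 / r) * Real.exp ((1 / r) ^ 2 * tZ + 1 / r * (tZ - μ)) ≤ r * 3 := by
    rw [one_div_one_div]
    have e1 : (1 / r) ^ 2 * tZ ≤ 1 := by
      have : (1 / r) ^ 2 * tZ = tZ / μ := by rw [← hsq]; field_simp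
      rw [this, div_le_one (by linarith)]; exact htZμ
    have e2 : 1 / r * (tZ - μ) ≤ 0 := mul_nonpos_of_nonneg_of_nonpos (by positivity) (by linarith)
    have e3 : Real.exp ((1 / r) ^ 2 * tZ + 1 / r * (tZ - μ)) ≤ Real.exp 1 :=
      Real.exp_le_exp.2 (by linarith)
    have := Real.exp_one_lt_three
    gcongr
    linarith
  have herrZ' : r * 3 ≤ μ / 1000 := by
    rw [← hsq]
    have := mul_le_mul_of_nonneg_left herrZ hr0.le
    linarith
  have herrY' : 200 * Real.exp (-((1 / 40000) * (μ : ℝ))) ≤ (1 / 500) * δ * μ := by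
    refine herrY.trans ?_
    have e1 : (1 / 500 : ℝ) / n = (1 / 500) * i := by rw [hi]; ring
    rw [e1]
    have e2 : δ * 1 ≤ δ * μ := mul_le_mul_of_nonneg_left hμ1 hδ0.le
    linarith
  have hHP : Hpot f δ P = M + 2 * δ * μ - (Y + 2 * δ * Z) := by
    unfold Hpot
    rw [← hM, ← hYdef, ← hZdef, min_eq_left]
    rw [hMeq]
    have : 0 ≤ μ * δ := by positivity
    linarith
  rw [hHP]
  -- combine
  have hmain : (24 / 100) * μ ≤ m + 2 * (tZ - Z) := by
    rcases min_choice (Z - (301 / 200) * Y) ((μ : ℝ) / 4) with hc | hc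
    · rw [← hmdef] at hc
      rcases min_choice (Z + Y * (1 - i)) (μ : ℝ) with hc2 | hc2
      · rw [← htZ] at hc2
        have := mul_le_mul_of_nonneg_left hin2 hY0
        rw [hc, hc2]; linarith
      · rw [← htZ] at hc2
        rw [hc, hc2]; linarith
    · rw [← hmdef] at hc
      rw [hc]; linarith
  have hmain' := mul_le_mul_of_nonneg_left hmain hδ0.le
  have hEZ' : 2 * δ * (tZ - μ / 1000) ≤ 2 * δ * EV n μ lam P (fun o => min (cge o f : ℝ) μ) :=
    mul_le_mul_of_nonneg_left (by linarith) (by linarith)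
  have hEY' : Y + δ * m - (1 / 500) * δ * μ ≤ EV n μ lam P (fun o => min (cge o (f + 1) : ℝ) M) := by
    linarith
  have hδμ : 0 ≤ δ * μ := by positivity
  linarith
/-! ### Potential for the loss probability -/

lemma core_ineq (u θ i δ Z Y vZ vY A B : ℝ) (hu : 0 < u) (hu1 : u ≤ 1 / 10)
    (hθ : θ = u ^ 2 / 4) (hi : i = u ^ 3) (hδ : i ≤ δ)
    (hYZ : Y ≤ Z) (hY0 : 0 ≤ Y) (hvZ : Z + Y / 2 ≤ vZ) (hvY : Y * (1 - i) + (Z - Y) * δ ≤ vY)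
    (hA : θ - θ ^ 2 ≤ A) (hA2 : A ≤ θ) (hB : u / 4 - (u / 4) ^ 2 ≤ B) (hB2 : B ≤ u / 4) :
    (Z - Y) * θ + Y * (u / 4) ≤ vZ * A + vY * (B - A) := by
  have p2 : 0 < u ^ 2 := by positivity
  have p3 : 0 < u ^ 3 := by positivity
  have p4 : 0 < u ^ 4 := by positivity
  have q2 : u ^ 2 ≤ u / 10 := by nlinarith
  have q3 : u ^ 3 ≤ u ^ 2 / 10 := by nlinarith
  have q4 : u ^ 4 ≤ u ^ 2 / 100 := by nlinarith
  have q5 : u ^ 5 ≤ u ^ 4 / 10 := by nlinarith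
  have hA' : u ^ 2 / 4 - u ^ 4 / 16 ≤ A := by rw [hθ] at hA; nlinarith
  have hA0 : 0 ≤ A := by linarith
  have hB' : u / 4 - u ^ 2 / 16 ≤ B := by nlinarith
  have hBA : u / 4 - 5 * u ^ 2 / 16 ≤ B - A := by rw [hθ] at hA2; linarith
  have hBA0 : 0 ≤ B - A := by linarith
  have hX : θ ≤ A + δ * (B - A) := by
    have e1 : i * (B - A) ≤ δ * (B - A) := mul_le_mul_of_nonneg_right hδ hBA0
    have e2 : u ^ 3 * (u / 4 - 5 * u ^ 2 / 16) ≤ i * (B - A) := by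
      rw [hi]; exact mul_le_mul_of_nonneg_left hBA p3.le
    have e3 : u ^ 3 * (u / 4 - 5 * u ^ 2 / 16) = u ^ 4 / 4 - 5 * u ^ 5 / 16 := by ring
    rw [hθ]; linarith
  have hYc : u / 4 ≤ (3 / 2) * A + (1 - i) * (B - A) := by
    have e1 : i * B ≤ u ^ 4 / 4 := by
      rw [hi]
      have := mul_le_mul_of_nonneg_left hB2 p3.le
      linarith
    have e2 : 0 ≤ i * A := by rw [hi]; positivity
    linarith
  have f1 := mul_le_mul_of_nonneg_right hvZ hA0
  have f2 := mul_le_mul_of_nonneg_right hvY hBA0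
  have f3 := mul_le_mul_of_nonneg_left hX (sub_nonneg.2 hYZ)
  have f4 := mul_le_mul_of_nonneg_left hYc hY0
  linarith

lemma exp_neg_bounds (x : ℝ) (hx : 0 ≤ x) (hx1 : x ≤ 1) :
    x - x ^ 2 ≤ 1 - Real.exp (-x) ∧ 1 - Real.exp (-x) ≤ x := by
  have := Real.abs_exp_sub_one_sub_id_le (x := -x) (by rw [abs_neg, abs_of_nonneg hx]; exact hx1)
  have h5 := (abs_le.1 this).2
  have h6 := Real.add_one_le_exp (-x)
  constructor
  · have : (-x) ^ 2 = x ^ 2 := by ring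
    linarith
  · linarith

noncomputable def gW {n μ : ℕ} (f : ℕ) (u : ℝ) (P : Fin μ → Pt n) : ℝ :=
  (cge P f : ℝ) + (1 / u - 1) * cge P (f + 1)

noncomputable def Vpot {n μ : ℕ} (f : ℕ) (u : ℝ) (P : Fin μ → Pt n) : ℝ :=
  if (cge P f : ℝ) < (μ : ℝ) / 4 then 1
  else min 1 (Real.exp (-((u ^ 2 / 4) * (gW f u P - (2 / 5) * μ))))

lemma Vpot_nonneg {n μ : ℕ} (f : ℕ) (u : ℝ) (P : Fin μ → Pt n) : 0 ≤ Vpot f u P := by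
  unfold Vpot
  split_ifs
  · norm_num
  · exact le_min (by norm_num) (Real.exp_pos _).le

lemma Vpot_le_one {n μ : ℕ} (f : ℕ) (u : ℝ) (P : Fin μ → Pt n) : Vpot f u P ≤ 1 := by
  unfold Vpot
  split_ifs
  · norm_num
  · exact min_le_left _ _

set_option maxHeartbeats 800000 in
lemma V_drift (n μ lam f : ℕ) (hn : 100 ≤ n) (hf : f < n) (hμ : 0 < μ)
    (hlam : Real.exp 1 * (μ : ℝ) ≤ (lam : ℝ)) (P : Fin μ → Pt n) (u : ℝ)
    (hu : 0 < u) (hu1 : u ≤ 1 / 10) (hun : 1 / (n : ℝ) = u ^ 3)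
    (hZ : (μ : ℝ) / 4 ≤ cge P f) :
    ∑ Q, stepProb n μ lam P Q * Vpot f u Q ≤
      Vpot f u P + 2 * Real.exp (-((μ : ℝ) * u ^ 2 / 1000)) := by
  have hVP : Vpot f u P = min 1 (Real.exp (-((u ^ 2 / 4) * (gW f u P - (2 / 5) * μ)))) := by
    unfold Vpot; rw [if_neg (by linarith)]
  have hμ1 : (1 : ℝ) ≤ μ := by exact_mod_cast hμ
  have hu2 : 0 < u ^ 2 := by positivity
  by_cases hg : gW f u P ≤ (2 / 5) * μ
  · have h1 : Vpot f u P = 1 := by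
      rw [hVP, min_eq_left]
      rw [Real.one_le_exp_iff]
      have := mul_nonneg (by positivity : 0 ≤ u ^ 2 / 4) (sub_nonneg.2 hg)
      linarith
    have h2 : ∑ Q, stepProb n μ lam P Q * Vpot f u Q ≤ EV n μ lam P (fun _ => 1) :=
      step_le_EV n μ lam P _ _ (fun _ => by norm_num) (fun o s _ => Vpot_le_one f u _)
    rw [EV_const n μ lam hμ] at h2
    have := Real.exp_pos (-((μ : ℝ) * u ^ 2 / 1000))
    linarith
  push Not at hg
  have hVP' : Vpot f u P = Real.exp (-((u ^ 2 / 4) * (gW f u P - (2 / 5) * μ))) := by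
    rw [hVP, min_eq_right]
    rw [Real.exp_le_one_iff]
    have := mul_nonneg (by positivity : 0 ≤ u ^ 2 / 4) (sub_nonneg.2 hg.le)
    linarith
  have hn' : (100 : ℝ) ≤ n := by exact_mod_cast hn
  have hn0 : (0 : ℝ) < n := by linarith
  have hf' : (f : ℝ) + 1 ≤ n := by exact_mod_cast hf
  have hin2 : 1 / (n : ℝ) ≤ 1 / 100 := one_div_le_one_div_of_le (by norm_num) hn'
  have hin0 : 0 < 1 / (n : ℝ) := by positivity
  have hδ1 : 1 / (n : ℝ) ≤ ((n : ℝ) - f) / n := by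
    apply div_le_div_of_nonneg_right <;> linarith
  have hrY := rate_Y n μ lam f (by omega) hf hμ hlam P
  have hrZ := rate_Z n μ lam f (by omega) hf hμ hlam P
  have hYZ : (cge P (f + 1) : ℝ) ≤ cge P f := by exact_mod_cast cge_anti P f
  have hY0 : (0 : ℝ) ≤ cge P (f + 1) := Nat.cast_nonneg _
  have hwinv : 10 ≤ 1 / u := by rw [le_div_iff₀ hu]; linarith
  have huinv : u * (1 / u) = 1 := by field_simp
  have hgdef : gW f u P = (cge P f : ℝ) + (1 / u - 1) * cge P (f + 1) := rfl
  set Y : ℝ := (cge P (f + 1) : ℝ) with hYdef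
  set Z : ℝ := (cge P f : ℝ) with hZdef
  set δ := ((n : ℝ) - f) / n with hδ
  set w := 1 / u with hw
  have hvY : Y * (1 - 1 / n) + (Z - Y) * δ ≤ lam * pT n μ P (f + 1) := by
    refine le_trans ?_ hrY
    have e1 : 0 ≤ Y * (1 - 1 / n) + (Z - Y) * δ :=
      add_nonneg (mul_nonneg hY0 (by linarith)) (mul_nonneg (by linarith) (by linarith))
    have e2 : 0 ≤ 1 / (2 * (n : ℝ)) := by positivity
    have := mul_nonneg e2 e1
    linarith
  have hvZ : Z + Y / 2 ≤ lam * pT n μ P f := by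
    refine le_trans ?_ hrZ
    have := mul_le_mul_of_nonneg_left hin2 hY0
    linarith
  -- exponential moment
  set θ := u ^ 2 / 4 with hθ
  have hθ0 : 0 < θ := by positivity
  have hθ1 : θ ≤ 1 := by rw [hθ]; nlinarith
  have hθw : θ * w = u / 4 := by rw [hθ, hw]; field_simp
  have hexp := EV_exp_le n μ lam hμ P f (-θ) (-(θ * (w - 1)))
  have hab : -θ + -(θ * (w - 1)) = -(u / 4) := by rw [← hθw]; ring
  rw [hab] at hexp
  have hbA := exp_neg_bounds θ hθ0.le hθ1
  have hbB := exp_neg_bounds (u / 4) (by linarith) (by linarith)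
  have hcore := core_ineq u θ (1 / n) δ Z Y _ _ (1 - Real.exp (-θ)) (1 - Real.exp (-(u / 4)))
    hu hu1 hθ hun hδ1 hYZ hY0 hvZ hvY hbA.1 hbA.2 hbB.1 hbB.2
  have hexp2 : EV n μ lam P (fun o => Real.exp (-θ * cge o f + -(θ * (w - 1)) * cge o (f + 1)))
      ≤ Real.exp (-(θ * gW f u P)) := by
    refine hexp.trans (Real.exp_le_exp.2 ?_)
    have e1 : θ * gW f u P = (Z - Y) * θ + Y * (u / 4) := by rw [hgdef, ← hθw]; ring
    rw [e1]
    linarith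
  -- lower tail for Z
  have htail : ∃ η : ℝ, 0 < η ∧ EV n μ lam P (fun o => Real.exp (η * (μ / 4)) *
      Real.exp ((-η) * cge o f)) ≤ Real.exp (-((μ : ℝ) * u ^ 2 / 1000)) := by
    by_cases hc : (3 / 10) * (μ : ℝ) ≤ Z
    · refine ⟨1 / 10, by norm_num, ?_⟩
      refine (EV_tail_le n μ lam hμ P f ((3 / 10) * μ) (μ / 4) (1 / 10) (by linarith)
        (by linarith) (by norm_num) (by norm_num)).trans (Real.exp_le_exp.2 ?_)
      have : (μ : ℝ) * u ^ 2 ≤ μ * 1 := mul_le_mul_of_nonneg_left (by nlinarith) (by linarith)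
      linarith
    · push Not at hc
      refine ⟨u / 20, by positivity, ?_⟩
      have hYl : μ * u / 10 ≤ Y := by
        rw [hgdef] at hg
        have e1 : μ / 10 ≤ w * Y := by linarith
        have e2 := mul_le_mul_of_nonneg_left e1 hu.le
        have e3 : u * (w * Y) = Y := by rw [← mul_assoc, huinv, one_mul]
        linarith
      have hμu : 0 < μ * u := by positivity
      have hμu2 : μ * u ≤ μ * (1 / 10) := mul_le_mul_of_nonneg_left hu1 (by linarith)
      refine (EV_tail_le n μ lam hμ P f (μ / 4 + μ * u / 20) (μ / 4) (u / 20) (by linarith)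
        (by linarith) (by positivity) (by linarith)).trans (Real.exp_le_exp.2 ?_)
      have e4 : (u / 20) ^ 2 * (μ / 4 + μ * u / 20) ≤ (u / 20) ^ 2 * ((3 / 10) * μ) :=
        mul_le_mul_of_nonneg_left (by linarith) (by positivity)
      have e5 : 0 < μ * u ^ 2 := by positivity
      linarith
  obtain ⟨η, hη, htail⟩ := htail
  have hstep : ∑ Q, stepProb n μ lam P Q * Vpot f u Q ≤
      EV n μ lam P (fun o => Real.exp (η * (μ / 4)) * Real.exp ((-η) * cge o f)
        + (Real.exp (θ * ((2 / 5) * μ)) *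
            Real.exp (-θ * cge o f + -(θ * (w - 1)) * cge o (f + 1))
          + Real.exp (-(θ * ((3 / 5) * μ))))) := by
    apply step_le_EV
    · intro o; positivity
    · intro o s hs
      have h1 : min (cge o (f + 1) : ℝ) μ ≤ cge (o ∘ s) (f + 1) := by
        exact_mod_cast sel_ge o s hs (f + 1)
      have h2 : min (cge o f : ℝ) μ ≤ cge (o ∘ s) f := by
        exact_mod_cast sel_ge o s hs f
      have h3 : (cge o (f + 1) : ℝ) ≤ cge o f := by exact_mod_cast cge_anti o f
      have p1 : 0 < Real.exp (η * (μ / 4)) * Real.exp ((-η) * cge o f) := by positivity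
      have p2 : 0 < Real.exp (θ * ((2 / 5) * μ)) *
            Real.exp (-θ * cge o f + -(θ * (w - 1)) * cge o (f + 1)) := by positivity
      have p3 := Real.exp_pos (-(θ * ((3 / 5) * μ)))
      unfold Vpot
      rw [← hθ]
      split_ifs with hl
      · have hB : (cge o f : ℝ) < μ / 4 := by
          rcases min_choice (cge o f : ℝ) μ with hc | hc
          · rw [hc] at h2; linarith
          · rw [hc] at h2; linarith
        have : 1 ≤ Real.exp (η * (μ / 4)) * Real.exp ((-η) * cge o f) := by
          rw [← Real.exp_add, Real.one_le_exp_iff]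
          have := mul_nonneg hη.le (sub_nonneg.2 hB.le)
          linarith
        linarith
      · refine (min_le_right _ _).trans ?_
        have hgd : gW f u (o ∘ s) = (cge (o ∘ s) f : ℝ) + (w - 1) * cge (o ∘ s) (f + 1) := rfl
        by_cases hc : (cge o f : ℝ) ≤ μ
        · rw [min_eq_left hc] at h2
          rw [min_eq_left (h3.trans hc)] at h1
          have h4 : (cge o f : ℝ) + (w - 1) * cge o (f + 1) ≤ gW f u (o ∘ s) := by
            rw [hgd]
            have := mul_le_mul_of_nonneg_left h1 (by linarith : 0 ≤ w - 1)
            linarith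
          have h5 : Real.exp (-(θ * (gW f u (o ∘ s) - 2 / 5 * μ))) ≤
              Real.exp (θ * ((2 / 5) * μ)) *
                Real.exp (-θ * cge o f + -(θ * (w - 1)) * cge o (f + 1)) := by
            rw [← Real.exp_add]
            apply Real.exp_le_exp.2
            have := mul_le_mul_of_nonneg_left h4 hθ0.le
            linarith
          linarith
        · push Not at hc
          rw [min_eq_right hc.le] at h2
          have h4 : (μ : ℝ) ≤ gW f u (o ∘ s) := by
            rw [hgd]
            have : 0 ≤ (w - 1) * (cge (o ∘ s) (f + 1) : ℝ) :=
              mul_nonneg (by linarith) (Nat.cast_nonneg _)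
            linarith
          have h5 : Real.exp (-(θ * (gW f u (o ∘ s) - 2 / 5 * μ))) ≤
              Real.exp (-(θ * ((3 / 5) * μ))) := by
            apply Real.exp_le_exp.2
            have := mul_le_mul_of_nonneg_left h4 hθ0.le
            linarith
          linarith
  rw [EV_add, EV_add, EV_const n μ lam hμ, EV_mul n μ lam P (Real.exp (θ * ((2 / 5) * μ)))] at hstep
  have h6 : Real.exp (θ * ((2 / 5) * μ)) * EV n μ lam P
      (fun o => Real.exp (-θ * cge o f + -(θ * (w - 1)) * cge o (f + 1))) ≤ Vpot f u P := by
    rw [hVP']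
    calc _ ≤ Real.exp (θ * ((2 / 5) * μ)) * Real.exp (-(θ * gW f u P)) :=
          mul_le_mul_of_nonneg_left hexp2 (Real.exp_pos _).le
      _ = _ := by rw [← Real.exp_add]; congr 1; ring
  have h7 : Real.exp (-(θ * ((3 / 5) * μ))) ≤ Real.exp (-((μ : ℝ) * u ^ 2 / 1000)) := by
    apply Real.exp_le_exp.2
    rw [hθ]
    have : 0 < μ * u ^ 2 := by positivity
    linarith
  linarith

set_option maxHeartbeats 1600000 in
theorem fin_core (n μ lam f : ℕ) (T L : ℝ) (hn : 100 ≤ n) (hf : f < n)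
    (hlam : Real.exp 1 * (μ : ℝ) ≤ (lam : ℝ))
    (hL : L = Real.log n) (hL100 : 100 ≤ L) (hT : 100 ≤ T) (hTn : (n : ℝ) = T ^ 3)
    (hμT : 1000000 * L * T ^ 2 ≤ (μ : ℝ))
    (P₀ : Fin μ → Pt n)
    (h0 : (μ : ℝ) / 2 ≤ (cntEq P₀ f : ℝ) + (cntGt P₀ f : ℝ)) :
    (∑' t : ℕ, ENNReal.ofReal (prEvent n μ lam P₀ t
            (fun path => ∀ s : Fin (t + 1),
              ¬ (lostLevel f (path s) ∨ gainLevel f (path s)))))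
          ≤ ENNReal.ofReal (8 * (n : ℝ) / ((n : ℝ) - (f : ℝ))) ∧
        (∑' t : ℕ, ENNReal.ofReal (prEvent n μ lam P₀ t
            (fun path => (∀ s : Fin (t + 1), (s : ℕ) < t →
                ¬ (lostLevel f (path s) ∨ gainLevel f (path s))) ∧
              lostLevel f (path (Fin.last t)))))
          ≤ ENNReal.ofReal (10 / (n : ℝ)) := by
  have hnR : (100 : ℝ) ≤ n := by exact_mod_cast hn
  have hn0 : (0 : ℝ) < n := by linarith
  have hfn : (f : ℝ) + 1 ≤ n := by exact_mod_cast hf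
  have hT2 : (10000 : ℝ) ≤ T ^ 2 := by nlinarith
  have hLT : L ≤ L * T ^ 2 := by nlinarith
  have hμL : 1000000 * L ≤ (μ : ℝ) := by nlinarith
  have hμR : (0 : ℝ) < μ := by linarith
  have hμ : 0 < μ := by exact_mod_cast hμR
  have hexpL : Real.exp (-L) = 1 / n := by
    rw [Real.exp_neg, hL, Real.exp_log hn0, one_div]
  have hsm : ∀ c : ℝ, 20 ≤ c → Real.exp (-(c * L)) ≤ (1 / 100000) * (1 / n) := by
    intro c hc
    have h1 : Real.exp (-(c * L)) ≤ Real.exp (-L) * Real.exp (-(1000 : ℝ)) := by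
      rw [← Real.exp_add]; apply Real.exp_le_exp.mpr; nlinarith
    have h2 : Real.exp (-(1000 : ℝ)) ≤ 1 / 100000 := by
      rw [Real.exp_neg, ← one_div]
      apply one_div_le_one_div_of_le (by norm_num)
      have := Real.quadratic_le_exp_of_nonneg (x := 1000) (by norm_num)
      linarith
    rw [hexpL] at h1
    have h3 : 0 < 1 / (n : ℝ) := by positivity
    nlinarith
  set u : ℝ := 1 / T with hu
  have hT0 : 0 < T := by linarith
  have hu0 : 0 < u := by positivity
  have hu1 : u ≤ 1 / 10 := by
    rw [hu]; apply one_div_le_one_div_of_le <;> linarith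
  have hun : 1 / (n : ℝ) = u ^ 3 := by rw [hu, hTn]; field_simp
  have huT : u * T = 1 := by rw [hu]; field_simp
  have hμu : 1000000 * L ≤ (μ : ℝ) * u ^ 2 := by
    have := mul_le_mul_of_nonneg_right hμT (sq_nonneg u)
    calc 1000000 * L = 1000000 * L * (u * T) ^ 2 := by rw [huT]; ring
      _ = 1000000 * L * T ^ 2 * u ^ 2 := by ring
      _ ≤ _ := this
  set δ : ℝ := ((n : ℝ) - f) / n with hδ
  have hδn : 1 / (n : ℝ) ≤ δ := by rw [hδ]; gcongr; linarith
  have hδ0 : 0 < δ := lt_of_lt_of_le (by positivity) hδn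
  have hδ1 : δ ≤ 1 := by
    rw [hδ, div_le_one hn0]; have : (0 : ℝ) ≤ f := Nat.cast_nonneg f
    linarith
  have h8 : 8 / δ = 8 * (n : ℝ) / ((n : ℝ) - f) := by
    rw [hδ]; have : (n : ℝ) - f ≠ 0 := by linarith
    field_simp
  set d : ℝ := (23 / 100) * δ * μ with hd
  have hd0 : 0 < d := by positivity
  have herrY : 200 * Real.exp (-((1 / 40000) * (μ : ℝ))) ≤ (1 / 500) / n := by
    have h1 : Real.exp (-((1 / 40000) * (μ : ℝ))) ≤ Real.exp (-(25 * L)) := by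
      apply Real.exp_le_exp.mpr; linarith
    have h2 := hsm 25 (by norm_num)
    have h3 : (1 / 500) / (n : ℝ) = 1 / 500 * (1 / n) := by ring
    rw [h3]
    linarith
  have herrZ : 3000 ≤ Real.sqrt μ := by
    apply Real.le_sqrt_of_sq_le; linarith
  have hst := stepProb_nonneg n μ lam
  have hZeq : ∀ P : Fin μ → Pt n, (cntEq P f : ℝ) + (cntGt P f : ℝ) = cge P f := by
    intro P; exact_mod_cast cntEq_add P f
  have hZ0 : (μ : ℝ) / 2 ≤ cge P₀ f := by rw [← hZeq]; exact h0
  have hA : ∀ P : Fin μ → Pt n, ¬ (lostLevel f P ∨ gainLevel f P) →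
      (μ : ℝ) / 4 ≤ cge P f ∧ (cge P (f + 1) : ℝ) < (μ : ℝ) / 2 := by
    intro P hP
    rw [not_or] at hP
    obtain ⟨h1, h2⟩ := hP
    unfold lostLevel at h1
    unfold gainLevel at h2
    rw [hZeq] at h1
    rw [cntGt_eq] at h2
    exact ⟨not_lt.mp h1, not_le.mp h2⟩
  have hHd : ∀ P : Fin μ → Pt n, ¬ (lostLevel f P ∨ gainLevel f P) →
      ∑ Q, stepProb n μ lam P Q * Hpot f δ Q ≤ Hpot f δ P - d := by
    intro P hP
    exact H_drift n μ lam f hn hf hμ hlam P δ hδ herrY herrZ (hA P hP).1 (hA P hP).2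
  have hH0 : Hpot f δ P₀ / d ≤ 8 / δ := by
    have hH : Hpot f δ P₀ ≤ (184 / 100) * μ := by
      unfold Hpot capY
      have hc : (0 : ℝ) ≤ (μ : ℝ) * (51 / 100 + δ / 4) := by positivity
      have hm : (0 : ℝ) ≤ min (cge P₀ (f + 1) : ℝ) ((μ : ℝ) * (51 / 100 + δ / 4)) :=
        le_min (Nat.cast_nonneg _) hc
      have h1 : δ * ((μ : ℝ) / 2) ≤ δ * cge P₀ f := mul_le_mul_of_nonneg_left hZ0 hδ0.le
      have h2 : δ * (μ : ℝ) ≤ 1 * μ := mul_le_mul_of_nonneg_right hδ1 hμR.le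
      nlinarith
    rw [div_le_div_iff₀ hd0 hδ0, hd]
    have := mul_le_mul_of_nonneg_right hH hδ0.le
    nlinarith
  constructor
  · rw [← h8]
    apply tsum_ofReal_le
    · intro t; exact prEvent_nonneg n μ lam hst P₀ t _
    · intro N
      exact (act_sum_le n μ lam hst (fun P => ¬ (lostLevel f P ∨ gainLevel f P)) (Hpot f δ) d
        (Hpot_nonneg f δ hδ0.le) hd0 hHd N P₀).trans hH0
  · set q : ℝ := 2 * Real.exp (-((μ : ℝ) * u ^ 2 / 1000)) with hq
    have hq0 : 0 < q := by positivity
    have hW0 : Vpot f u P₀ + (q / d) * Hpot f δ P₀ ≤ 10 / n := by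
      have hV : Vpot f u P₀ ≤ 1 / n := by
        unfold Vpot
        rw [if_neg (by linarith)]
        refine (min_le_right _ _).trans ?_
        rw [← hexpL]
        apply Real.exp_le_exp.mpr
        have hg : (μ : ℝ) / 2 ≤ gW f u P₀ := by
          unfold gW
          have h1 : (0 : ℝ) ≤ 1 / u - 1 := by
            rw [sub_nonneg, le_div_iff₀ hu0]; linarith
          have h2 := mul_nonneg h1 (Nat.cast_nonneg (α := ℝ) (cge P₀ (f + 1)))
          linarith
        have h3 : (u ^ 2 / 4) * ((μ : ℝ) / 10) ≤ (u ^ 2 / 4) * (gW f u P₀ - (2 / 5) * μ) := by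
          apply mul_le_mul_of_nonneg_left _ (by positivity)
          linarith
        linarith
      have hqs : q ≤ 2 * ((1 / 100000) * (1 / n) * (1 / n)) := by
        have h1 : Real.exp (-((μ : ℝ) * u ^ 2 / 1000))
            ≤ Real.exp (-(20 * L)) * Real.exp (-(20 * L)) := by
          rw [← Real.exp_add]; apply Real.exp_le_exp.mpr; linarith
        have h2 := hsm 20 (by norm_num)
        have h3 := mul_le_mul h2 h2 (Real.exp_pos _).le (by positivity)
        have h4 : 0 ≤ 1 / (n : ℝ) * (1 / n) := by positivity
        have h5 : (1 / 100000) * (1 / (n : ℝ)) * ((1 / 100000) * (1 / n))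
            = (1 / 10000000000) * (1 / (n : ℝ) * (1 / n)) := by ring
        have h6 : (1 / 100000) * (1 / (n : ℝ)) * (1 / n)
            = (1 / 100000) * (1 / (n : ℝ) * (1 / n)) := by ring
        rw [h5] at h3
        rw [hq, h6]
        linarith
      have h5 : (q / d) * Hpot f δ P₀ ≤ q * (8 * n) := by
        have h6 : 8 / δ ≤ 8 * n := by
          rw [div_le_iff₀ hδ0]
          rw [div_le_iff₀ hn0] at hδn
          linarith
        calc (q / d) * Hpot f δ P₀ = q * (Hpot f δ P₀ / d) := by ring
          _ ≤ q * (8 * n) := mul_le_mul_of_nonneg_left (hH0.trans h6) hq0.le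
      have h7 : q * (8 * n) ≤ 1 / n := by
        have h8 := mul_le_mul_of_nonneg_right hqs (by positivity : (0 : ℝ) ≤ 8 * n)
        have h9 : 2 * ((1 / 100000) * (1 / (n : ℝ)) * (1 / n)) * (8 * n)
            = (16 / 100000) * (1 / n) := by field_simp; norm_num
        have h10 : (0 : ℝ) < 1 / n := by positivity
        linarith
      have h11 : (10 : ℝ) / n = 10 * (1 / n) := by ring
      have h10 : (0 : ℝ) < 1 / n := by positivity
      rw [h11]; linarith
    apply tsum_ofReal_le
    · intro t; exact prEvent_nonneg n μ lam hst P₀ t _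
    · intro N
      refine (loss_sum_le n μ lam hst (fun P => ¬ (lostLevel f P ∨ gainLevel f P))
        (fun P => lostLevel f P) (fun P => Vpot f u P + (q / d) * Hpot f δ P)
        ?_ ?_ ?_ ?_ N P₀).trans hW0
      · intro P
        have h1 := Vpot_nonneg f u P
        have h2 := Hpot_nonneg f δ hδ0.le P
        positivity
      · intro P hP
        have h1 : Vpot f u P = 1 := by
          unfold lostLevel at hP
          rw [hZeq] at hP
          unfold Vpot
          rw [if_pos hP]
        have h2 := Hpot_nonneg f δ hδ0.le P
        have h3 : 0 ≤ (q / d) * Hpot f δ P := by positivity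
        linarith
      · intro P hP hB
        exact hP (Or.inl hB)
      · intro P hP
        have h1 := V_drift n μ lam f hn hf hμ hlam P u hu0 hu1 hun (hA P hP).1
        have h2 := mul_le_mul_of_nonneg_left (hHd P hP) (by positivity : 0 ≤ q / d)
        have h3 : ∑ Q, stepProb n μ lam P Q * (Vpot f u Q + (q / d) * Hpot f δ Q)
            = ∑ Q, stepProb n μ lam P Q * Vpot f u Q
              + (q / d) * ∑ Q, stepProb n μ lam P Q * Hpot f δ Q := by
          rw [Finset.mul_sum, ← Finset.sum_add_distrib]
          apply Finset.sum_congr rfl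
          intro Q _; ring
        have h4 : (q / d) * (Hpot f δ P - d) = (q / d) * Hpot f δ P - q := by
          field_simp
        rw [h4] at h2
        have h5 : ∑ Q, stepProb n μ lam P Q * (Vpot f u Q + (q / d) * Hpot f δ Q)
            ≤ Vpot f u P + (q / d) * Hpot f δ P := by
          rw [h3]; linarith
        exact h5

/-- Let `λ(n) ≥ e μ(n)`, `λ(n)/μ(n)` at most polynomial in `n`, and
`μ(n) = n^{2/3} h(n)` with `h(n) ≥ (ln n)^4`.  Suppose the current level is some `f`
with `n/3 < f < n`.  For `n` large enough: the expected number of generations until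
the algorithm either loses or gains a level is at most `8n/(n-f)`, and the
probability that this results in a level loss is at most `10/n`. -/
theorem stmt19 (μ lam : ℕ → ℕ) (h : ℕ → ℝ)
    (hlam : ∀ n, Real.exp 1 * (μ n : ℝ) ≤ (lam n : ℝ))
    (k : ℕ) (hratio : ∀ n, (lam n : ℝ) / (μ n : ℝ) ≤ (n : ℝ) ^ k)
    (hμeq : ∀ n : ℕ, (μ n : ℝ) = (n : ℝ) ^ ((2 : ℝ) / 3) * h n)
    (hh : ∀ n : ℕ, (Real.log (n : ℝ)) ^ 4 ≤ h n) :
    ∃ n₀ : ℕ, ∀ n ≥ n₀, ∀ fval : ℕ, (n : ℝ) / 3 < (fval : ℝ) → fval < n →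
      ∀ P₀ : Fin (μ n) → Pt n,
        (μ n : ℝ) / 2 ≤ (cntEq P₀ fval : ℝ) + (cntGt P₀ fval : ℝ) →
        (cntGt P₀ fval : ℝ) < (μ n : ℝ) / 2 →
        -- expected number of generations until the level is lost or gained
        (∑' t : ℕ, ENNReal.ofReal (prEvent n (μ n) (lam n) P₀ t
            (fun path => ∀ s : Fin (t + 1),
              ¬ (lostLevel fval (path s) ∨ gainLevel fval (path s)))))
          ≤ ENNReal.ofReal (8 * (n : ℝ) / ((n : ℝ) - (fval : ℝ))) ∧
        -- probability that the first of the two events to occur is a level loss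
        (∑' t : ℕ, ENNReal.ofReal (prEvent n (μ n) (lam n) P₀ t
            (fun path => (∀ s : Fin (t + 1), (s : ℕ) < t →
                ¬ (lostLevel fval (path s) ∨ gainLevel fval (path s))) ∧
              lostLevel fval (path (Fin.last t)))))
          ≤ ENNReal.ofReal (10 / (n : ℝ)) := by
  obtain ⟨n₀, hn₀⟩ := exists_nat_ge (Real.exp 100)
  refine ⟨max n₀ 1000000, ?_⟩
  intro n hn f _ hf P₀ h0 _
  have hn1 : n₀ ≤ n := le_trans (le_max_left _ _) hn
  have hn2 : 1000000 ≤ n := le_trans (le_max_right _ _) hn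
  have hn1R : (n₀ : ℝ) ≤ n := by exact_mod_cast hn1
  have hn2R : (1000000 : ℝ) ≤ n := by exact_mod_cast hn2
  have hn0 : (0 : ℝ) < n := by linarith
  have hL100 : 100 ≤ Real.log n := by
    rw [Real.le_log_iff_exp_le hn0]; linarith
  have hT3 : ((n : ℝ) ^ ((1 : ℝ) / 3)) ^ 3 = n := by
    rw [← Real.rpow_natCast, ← Real.rpow_mul hn0.le]; norm_num
  have hT2 : ((n : ℝ) ^ ((1 : ℝ) / 3)) ^ 2 = (n : ℝ) ^ ((2 : ℝ) / 3) := by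
    rw [← Real.rpow_natCast, ← Real.rpow_mul hn0.le]; norm_num
  have hT0 : 0 < (n : ℝ) ^ ((1 : ℝ) / 3) := Real.rpow_pos_of_pos hn0 _
  have hT : 100 ≤ (n : ℝ) ^ ((1 : ℝ) / 3) := by
    by_contra hc
    have hc := not_le.mp hc
    have := pow_lt_pow_left₀ hc hT0.le (by norm_num : 3 ≠ 0)
    rw [hT3] at this
    linarith
  have hL4 : 1000000 * Real.log n ≤ (Real.log n) ^ 4 := by
    have h3 : (100 : ℝ) ^ 3 ≤ (Real.log n) ^ 3 := by gcongr
    have h4 := mul_le_mul_of_nonneg_right h3 (by linarith : 0 ≤ Real.log n)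
    calc 1000000 * Real.log n = (100 : ℝ) ^ 3 * Real.log n := by norm_num
      _ ≤ _ := h4
      _ = _ := by ring
  refine fin_core n (μ n) (lam n) f ((n : ℝ) ^ ((1 : ℝ) / 3)) (Real.log n) (by omega) hf
    (hlam n) rfl hL100 hT hT3.symm ?_ P₀ h0
  rw [hT2, hμeq n, mul_comm]
  exact mul_le_mul_of_nonneg_left (hL4.trans (hh n)) (Real.rpow_nonneg hn0.le _)
end
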